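/- Let n ≥ 1, 0 < s < 1 and 0 < α < 1. Let u ∈ C^{1,1}_{loc}(ℝⁿ) ∩ L_{2s} be a nonnegative classical solution of (-Δ)^s u = f in B_1(0), where f ∈ C^α(B_1(0)). Then for every 0 < ε < 2s, ‖u‖_{C^{[2s+α−ε],{2s+α−ε}}(B_{1/2}(0))} ≤ C (‖f‖_{C^α(B_1(0))} + ‖u‖_{L^∞(B_1(0))}), where C depends only on n, s, α and ε. -/

import Mathlib

open MeasureTheory Metric Set Filter
open scoped Topology NNReal ENNReal RealInnerProductSpace

noncomputable section

/-- `n`-dimensional Euclidean space `ℝⁿ`. -/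
abbrev Euc (n : ℕ) := EuclideanSpace ℝ (Fin n)

/-- The standard normalization constant `C_{n,s}` of the fractional Laplacian,
`C_{n,s} = 4^s Γ(n/2+s) / (π^{n/2} |Γ(-s)|) = s·4^s·Γ(n/2+s) / (π^{n/2} Γ(1-s))`. -/
def fracC (n : ℕ) (s : ℝ) : ℝ :=
  s * 4 ^ s * Real.Gamma ((n : ℝ) / 2 + s) /
    (Real.pi ^ ((n : ℝ) / 2) * Real.Gamma (1 - s))

/-- `(-Δ)^s u (x) = v` in the classical (Cauchy principal value) sense: the truncated
integrals `C_{n,s} ∫_{|x-y| ≥ ε} (u(x) - u(y))/|x-y|^{n+2s} dy` tend to `v` as `ε → 0⁺`. -/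
def HasFracLapAt (n : ℕ) (s : ℝ) (u : Euc n → ℝ) (x : Euc n) (v : ℝ) : Prop :=
  Tendsto (fun ε : ℝ =>
      fracC n s *
        ∫ y in {y : Euc n | ε ≤ dist x y}, (u x - u y) / dist x y ^ ((n : ℝ) + 2 * s))
    (𝓝[>] (0 : ℝ)) (𝓝 v)

/-- The tail space `L_{2s}`: locally integrable functions with
`∫_{ℝⁿ} |u(y)|/(1+|y|^{n+2s}) dy < ∞`. -/
def MemL2s (n : ℕ) (s : ℝ) (u : Euc n → ℝ) : Prop :=
  LocallyIntegrable u volume ∧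
    Integrable (fun y : Euc n => |u y| / (1 + ‖y‖ ^ ((n : ℝ) + 2 * s))) volume

/-- The `L_{2s}` norm `‖u‖_{L_{2s}} = ∫_{ℝⁿ} |u(y)|/(1+|y|^{n+2s}) dy`. -/
def l2sNorm (n : ℕ) (s : ℝ) (u : Euc n → ℝ) : ℝ :=
  ∫ y : Euc n, |u y| / (1 + ‖y‖ ^ ((n : ℝ) + 2 * s))

/-- `u ∈ C^{1,1}_{loc}(Ω)`: near every point of `Ω`, `u` is `C^1` with a Lipschitz
continuous derivative. -/
def C11LocOn (n : ℕ) (u : Euc n → ℝ) (Ω : Set (Euc n)) : Prop :=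
  ∀ x ∈ Ω, ∃ ε > 0, ball x ε ⊆ Ω ∧ ContDiffOn ℝ 1 u (ball x ε) ∧
    ∃ L : ℝ≥0, LipschitzOnWith L (fun y => fderiv ℝ u y) (ball x ε)

/-- The `C^γ(K)` norm (`0 < γ < 1`) of `u` is bounded by `A`: both the sup norm and the
`γ`-Hölder seminorm of `u` on `K` are at most `A`. -/
def HolderBoundOn (n : ℕ) (γ : ℝ) (u : Euc n → ℝ) (K : Set (Euc n)) (A : ℝ) : Prop :=
  (∀ x ∈ K, |u x| ≤ A) ∧ ∀ x ∈ K, ∀ y ∈ K, |u x - u y| ≤ A * dist x y ^ γ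

/-- Two-sided (interior and exterior) tangent ball condition of radius `ρ` at a boundary
point `z` of `Ω`.  A uniform two-sided ball condition is the standard geometric
characterization of a (locally) `C^{1,1}` boundary: the radius `ρ` is controlled by the
local `C^{1,1}` norm of `∂Ω` and vice versa. -/
def TwoSidedBallAt (n : ℕ) (Ω : Set (Euc n)) (ρ : ℝ) (z : Euc n) : Prop :=
  ∃ ν : Euc n, ‖ν‖ = 1 ∧ ball (z + ρ • ν) ρ ⊆ Ω ∧ ball (z - ρ • ν) ρ ⊆ Ωᶜ

/-- The `C^{[γ],{γ}}(K)` norm of `u` is bounded by `A` (here `m = [γ]` and the real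
parameter `γfrac = {γ}` is the fractional part): `u` is `C^m`, all derivatives of order
`≤ m` are bounded by `A` on `K`, and the order-`m` derivative is `{γ}`-Hölder on `K`
with constant `A`. -/
def HigherHolderBoundOn (n : ℕ) (m : ℕ) (γfrac : ℝ) (u : Euc n → ℝ) (K : Set (Euc n))
    (A : ℝ) : Prop :=
  ContDiffOn ℝ m u K ∧
    (∀ k ≤ m, ∀ x ∈ K, ‖iteratedFDeriv ℝ k u x‖ ≤ A) ∧
    ∀ x ∈ K, ∀ y ∈ K,
      ‖iteratedFDeriv ℝ m u x - iteratedFDeriv ℝ m u y‖ ≤ A * dist x y ^ γfrac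

section ParametricSmoothness

variable {T E G : Type*} [MeasurableSpace T] [NormedAddCommGroup E] [NormedSpace ℝ E]
  [NormedAddCommGroup G] [NormedSpace ℝ G] [CompleteSpace G]

/-- Differentiation under the integral sign, for iterated derivatives. -/
theorem hasFTaylorSeriesUpToOn_integral {μ : Measure T} {F : T → E → G} {U : Set E} {m : ℕ}
    {b : ℕ → T → ℝ} (hU : IsOpen U) (hF : ∀ t, ContDiff ℝ m (F t))
    (hmeas : ∀ k ≤ m, ∀ x ∈ U, AEStronglyMeasurable (fun t => iteratedFDeriv ℝ k (F t) x) μ)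
    (hb : ∀ k ≤ m, Integrable (b k) μ)
    (hbound : ∀ k ≤ m, ∀ᵐ t ∂μ, ∀ x ∈ U, ‖iteratedFDeriv ℝ k (F t) x‖ ≤ b k t) :
    HasFTaylorSeriesUpToOn m (fun x => ∫ t, F t x ∂μ)
      (fun x k => ∫ t, iteratedFDeriv ℝ k (F t) x ∂μ) U := by
  have hInt : ∀ k ≤ m, ∀ x ∈ U, Integrable (fun t => iteratedFDeriv ℝ k (F t) x) μ := by
    intro k hk x hx
    refine (hb k hk).mono' (hmeas k hk x hx) ?_
    filter_upwards [hbound k hk] with t ht using ht x hx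
  have hcont : ∀ k ≤ m, ContinuousOn (fun x => ∫ t, iteratedFDeriv ℝ k (F t) x ∂μ) U := by
    intro k hk x hx
    refine (continuousAt_of_dominated (bound := b k) ?_ ?_ (hb k hk) ?_).continuousWithinAt
    · filter_upwards [hU.mem_nhds hx] with y hy using hmeas k hk y hy
    · filter_upwards [hU.mem_nhds hx] with y hy
      filter_upwards [hbound k hk] with t ht using ht y hy
    · refine Eventually.of_forall fun t => ?_
      exact ((hF t).continuous_iteratedFDeriv (by exact_mod_cast hk)).continuousAt
  refine ⟨?_, ?_, ?_⟩
  · intro x hx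
    have h := (continuousMultilinearCurryFin0 ℝ E G).toContinuousLinearEquiv.integral_comp_comm
      (μ := μ) (fun t => iteratedFDeriv ℝ 0 (F t) x)
    simp only [LinearIsometryEquiv.coe_toContinuousLinearEquiv,
      continuousMultilinearCurryFin0_apply] at h
    rw [ContinuousMultilinearMap.curry0, ← h]
    simp
  · intro k hk x hx
    have hk' : k < m := by exact_mod_cast hk
    have h := hasFDerivAt_integral_of_dominated_of_fderiv_le (μ := μ) (𝕜 := ℝ)
      (F := fun y t => iteratedFDeriv ℝ k (F t) y)
      (F' := fun y t => (iteratedFDeriv ℝ (k + 1) (F t) y).curryLeft)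
      (bound := b (k + 1)) (hU.mem_nhds hx) ?_ (hInt k hk'.le x hx) ?_ ?_ (hb (k + 1) hk') ?_
    · have e' : ∫ t, (iteratedFDeriv ℝ (k + 1) (F t) x).curryLeft ∂μ =
          (∫ t, iteratedFDeriv ℝ (k + 1) (F t) x ∂μ).curryLeft := by
        exact ContinuousLinearMap.integral_comp_comm (μ := μ) (𝕜 := ℝ)
          (E := E [×(k + 1)]→L[ℝ] G) (Fₗ := E →L[ℝ] (E [×k]→L[ℝ] G))
          ((continuousMultilinearCurryLeftEquiv ℝ (fun _ : Fin (k + 1) => E)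
          G).toLinearIsometry.toContinuousLinearMap)
          (hInt (k + 1) hk' x hx)
      rw [e'] at h
      exact h.hasFDerivWithinAt
    · filter_upwards [hU.mem_nhds hx] with y hy using hmeas k hk'.le y hy
    · exact (continuousMultilinearCurryLeftEquiv ℝ (fun _ : Fin (k + 1) => E)
        G).continuous.comp_aestronglyMeasurable (hmeas (k + 1) hk' x hx)
    · filter_upwards [hbound (k + 1) hk'] with t ht y hy
      rw [ContinuousMultilinearMap.curryLeft_norm]
      exact ht y hy
    · refine Eventually.of_forall fun t y hy => ?_
      have h1 : HasFTaylorSeriesUpTo m (F t) (ftaylorSeries ℝ (F t)) :=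
        (contDiff_iff_ftaylorSeries).1 (hF t)
      exact h1.fderiv k hk y
  · intro k hk
    exact hcont k (by exact_mod_cast hk)

theorem contDiffOn_integral {μ : Measure T} {F : T → E → G} {U : Set E} {m : ℕ}
    {b : ℕ → T → ℝ} (hU : IsOpen U) (hF : ∀ t, ContDiff ℝ m (F t))
    (hmeas : ∀ k ≤ m, ∀ x ∈ U, AEStronglyMeasurable (fun t => iteratedFDeriv ℝ k (F t) x) μ)
    (hb : ∀ k ≤ m, Integrable (b k) μ)
    (hbound : ∀ k ≤ m, ∀ᵐ t ∂μ, ∀ x ∈ U, ‖iteratedFDeriv ℝ k (F t) x‖ ≤ b k t) :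
    ContDiffOn ℝ m (fun x => ∫ t, F t x ∂μ) U :=
  (hasFTaylorSeriesUpToOn_integral hU hF hmeas hb hbound).contDiffOn

theorem iteratedFDeriv_integral {μ : Measure T} {F : T → E → G} {U : Set E} {m : ℕ}
    {b : ℕ → T → ℝ} (hU : IsOpen U) (hF : ∀ t, ContDiff ℝ m (F t))
    (hmeas : ∀ k ≤ m, ∀ x ∈ U, AEStronglyMeasurable (fun t => iteratedFDeriv ℝ k (F t) x) μ)
    (hb : ∀ k ≤ m, Integrable (b k) μ)
    (hbound : ∀ k ≤ m, ∀ᵐ t ∂μ, ∀ x ∈ U, ‖iteratedFDeriv ℝ k (F t) x‖ ≤ b k t)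
    {k : ℕ} (hk : k ≤ m) {x : E} (hx : x ∈ U) :
    iteratedFDeriv ℝ k (fun x => ∫ t, F t x ∂μ) x = ∫ t, iteratedFDeriv ℝ k (F t) x ∂μ := by
  rw [← iteratedFDerivWithin_of_isOpen k hU hx]
  exact ((hasFTaylorSeriesUpToOn_integral hU hF hmeas hb hbound).eq_iteratedFDerivWithin_of_uniqueDiffOn
    (by exact_mod_cast hk) hU.uniqueDiffOn hx).symm

end ParametricSmoothness

section Kernels

/-- The kernel `‖z‖^{-(n+2s)}`. -/
def rker (n : ℕ) (s : ℝ) (z : Euc n) : ℝ := ‖z‖ ^ (-((n : ℝ) + 2 * s))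

/-- The weight `(1 + ‖x‖)^{-(n+2s)}`. -/
def wt (n : ℕ) (s : ℝ) (x : Euc n) : ℝ := (1 + ‖x‖) ^ (-((n : ℝ) + 2 * s))

variable {n : ℕ} {s : ℝ}

theorem rker_nonneg (z : Euc n) : 0 ≤ rker n s z := Real.rpow_nonneg (norm_nonneg _) _

theorem wt_pos (x : Euc n) : 0 < wt n s x := Real.rpow_pos_of_pos (by positivity) _

theorem rker_neg (z : Euc n) : rker n s (-z) = rker n s z := by simp [rker]

theorem wt_neg (z : Euc n) : wt n s (-z) = wt n s z := by simp [wt]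

theorem measurable_rker : Measurable (rker n s) := by
  unfold rker; fun_prop

theorem continuous_wt : Continuous (wt n s) := by
  unfold wt
  refine (continuous_const.add continuous_norm).rpow_const fun x => Or.inl ?_
  exact (by positivity : (0 : ℝ) < 1 + ‖x‖).ne'

theorem integrable_wt (hs : 0 < s) : Integrable (wt n s) := by
  refine integrable_one_add_norm ?_
  simp; linarith

theorem wt_le_one (hs : 0 < s) (x : Euc n) : wt n s x ≤ 1 :=
  Real.rpow_le_one_of_one_le_of_nonpos (by linarith [norm_nonneg x]) (by
    have : (0 : ℝ) ≤ n := by positivity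
    linarith)

theorem integrable_rker_min (hn : 1 ≤ n) (hs0 : 0 < s) (hs1 : s < 1) :
    Integrable (fun z : Euc n => rker n s z * min 1 (‖z‖ ^ 2)) := by
  have : Nonempty (Fin n) := ⟨⟨0, hn⟩⟩
  have h := integrable_fun_norm_addHaar (volume : Measure (Euc n))
    (f := fun r : ℝ => r ^ (-((n : ℝ) + 2 * s)) * min 1 (r ^ 2))
  refine h.2 ?_
  simp only [finrank_euclideanSpace, Fintype.card_fin, smul_eq_mul]
  rw [← Ioc_union_Ioi_eq_Ioi (zero_le_one' ℝ)]
  have e : ∀ r : ℝ, 0 < r → ∀ a : ℝ, r ^ (n - 1) * r ^ (-((n : ℝ) + 2 * s)) * r ^ a =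
      r ^ (a - 1 - 2 * s) := by
    intro r hr a
    rw [← Real.rpow_natCast, ← Real.rpow_add hr, ← Real.rpow_add hr]
    congr 1
    push_cast [hn]
    ring
  refine IntegrableOn.union ?_ ?_
  · have h1 : IntegrableOn (fun r : ℝ => r ^ (2 - 1 - 2 * s)) (Ioc 0 1) := by
      rw [← intervalIntegrable_iff_integrableOn_Ioc_of_le zero_le_one]
      exact intervalIntegral.intervalIntegrable_rpow' (by linarith)
    refine h1.congr_fun (fun r hr => ?_) measurableSet_Ioc
    simp only
    rw [← e r hr.1 2, min_eq_right (by have := hr.1; have := hr.2; nlinarith)]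
    norm_cast
    ring
  · have h1 : IntegrableOn (fun r : ℝ => r ^ (0 - 1 - 2 * s)) (Ioi 1) :=
      integrableOn_Ioi_rpow_of_lt (by linarith) one_pos
    refine h1.congr_fun (fun r hr => ?_) measurableSet_Ioi
    have hr' : (1 : ℝ) < r := hr
    simp only
    rw [← e r (by linarith) 0, min_eq_left (by nlinarith)]
    simp

theorem rker_le_wt (hs : 0 < s) {δ : ℝ} (hδ : 0 < δ) {x z : Euc n}
    (h : δ * (1 + ‖x‖) ≤ ‖z‖) : rker n s z ≤ δ ^ (-((n : ℝ) + 2 * s)) * wt n s x := by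
  unfold rker wt
  rw [← Real.mul_rpow hδ.le (by positivity)]
  exact Real.rpow_le_rpow_of_nonpos (by positivity) h (by
    have : (0 : ℝ) ≤ n := by positivity
    linarith)

theorem wt_le_wt (hs : 0 < s) {δ : ℝ} (hδ : 0 < δ) {x z : Euc n}
    (h : δ * (1 + ‖x‖) ≤ 1 + ‖z‖) : wt n s z ≤ δ ^ (-((n : ℝ) + 2 * s)) * wt n s x := by
  unfold wt
  rw [← Real.mul_rpow hδ.le (by positivity)]
  exact Real.rpow_le_rpow_of_nonpos (by positivity) h (by
    have : (0 : ℝ) ≤ n := by positivity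
    linarith)

theorem wt_sub_le (hs : 0 < s) {x : Euc n} (hx : ‖x‖ ≤ 1) (y : Euc n) :
    wt n s (x - y) ≤ (1 / 2 : ℝ) ^ (-((n : ℝ) + 2 * s)) * wt n s y := by
  refine wt_le_wt hs (by norm_num) ?_
  have := norm_sub_norm_le y x
  rw [norm_sub_rev] at this
  have := norm_nonneg (x - y)
  linarith

theorem wt_smul_le (hs : 0 < s) {τ : ℝ} (h0 : 0 < τ) (h1 : τ ≤ 1) (x : Euc n) :
    wt n s (τ • x) ≤ τ ^ (-((n : ℝ) + 2 * s)) * wt n s x := by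
  refine wt_le_wt hs h0 ?_
  rw [norm_smul, Real.norm_of_nonneg h0.le]
  linarith

end Kernels

section SecondDifference

variable {n : ℕ} {s : ℝ} {F : Type*} [NormedAddCommGroup F] [NormedSpace ℝ F]

/-- The symmetric second difference `2 g(x) - g(x+z) - g(x-z)`. -/
def secDiff (g : Euc n → F) (z x : Euc n) : F := (2 : ℝ) • g x - g (x + z) - g (x - z)

/-- The operator `g ↦ ∫ (2 g(x) - g(x+z) - g(x-z)) ‖z‖^{-(n+2s)} dz`. -/
def nlop (n : ℕ) (s : ℝ) (g : Euc n → F) (x : Euc n) : F := ∫ z, rker n s z • secDiff g z x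

theorem norm_taylor_le {g : Euc n → F} {x z : Euc n} {r : ℝ} {L : ℝ≥0}
    (hd : ∀ y ∈ ball x r, DifferentiableAt ℝ g y)
    (hL : LipschitzOnWith L (fun y => fderiv ℝ g y) (ball x r)) (hz : ‖z‖ < r) :
    ‖g (x + z) - g x - fderiv ℝ g x z‖ ≤ L * ‖z‖ ^ 2 := by
  have hr : 0 < r := (norm_nonneg z).trans_lt hz
  have hsub : closedBall x ‖z‖ ⊆ ball x r := closedBall_subset_ball hz
  have h := (convex_closedBall x ‖z‖).norm_image_sub_le_of_norm_fderiv_le' (𝕜 := ℝ) (f := g)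
    (φ := fderiv ℝ g x) (C := L * ‖z‖) (x := x) (y := x + z) (fun y hy => hd y (hsub hy)) ?_ ?_ ?_
  · simpa [pow_two, mul_assoc] using h
  · intro y hy
    have := hL.dist_le_mul y (hsub hy) x (mem_ball_self hr)
    rw [dist_eq_norm] at this
    refine this.trans ?_
    gcongr
    exact hy
  · simp
  · simp

theorem norm_secDiff_le_of_lipschitz {g : Euc n → F} {x z : Euc n} {r : ℝ} {L : ℝ≥0}
    (hd : ∀ y ∈ ball x r, DifferentiableAt ℝ g y)
    (hL : LipschitzOnWith L (fun y => fderiv ℝ g y) (ball x r)) (hz : ‖z‖ < r) :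
    ‖secDiff g z x‖ ≤ 2 * L * ‖z‖ ^ 2 := by
  have h1 := norm_taylor_le hd hL hz
  have h2 := norm_taylor_le (z := -z) hd hL (by simpa using hz)
  have e : secDiff g z x = -((g (x + z) - g x - fderiv ℝ g x z) +
      (g (x + -z) - g x - fderiv ℝ g x (-z))) := by
    simp only [secDiff, map_neg, two_smul, ← sub_eq_add_neg]
    abel
  rw [e, norm_neg]
  refine (norm_add_le _ _).trans ?_
  rw [norm_neg] at h2
  linarith

theorem continuous_secDiff {g : Euc n → F} (hg : Continuous g) :
    Continuous (fun p : Euc n × Euc n => secDiff g p.1 p.2) := by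
  unfold secDiff; fun_prop

theorem exists_norm_secDiff_le {g : Euc n → F} (hg : ContDiff ℝ 2 g) (hc : HasCompactSupport g) :
    ∃ A, 0 ≤ A ∧ ∀ x z, ‖secDiff g z x‖ ≤ A * min 1 (‖z‖ ^ 2) := by
  obtain ⟨B, hB⟩ := hc.exists_bound_of_continuous hg.continuous
  have hg' : ContDiff ℝ 1 (fderiv ℝ g) := hg.fderiv_right (by norm_num)
  obtain ⟨L, hL⟩ := ContDiff.lipschitzWith_of_hasCompactSupport (hc.fderiv (𝕜 := ℝ)) hg' (by simp)
  have hB0 : 0 ≤ B := (norm_nonneg _).trans (hB 0)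
  refine ⟨max (4 * B) (2 * L), by positivity, fun x z => ?_⟩
  rcases le_total 1 (‖z‖ ^ 2) with h | h
  · rw [min_eq_left h, mul_one]
    refine le_max_of_le_left ?_
    refine (norm_sub_le _ _).trans ?_
    refine (add_le_add (norm_sub_le _ _) le_rfl).trans ?_
    rw [norm_smul, Real.norm_ofNat]
    linarith [hB x, hB (x + z), hB (x - z)]
  · rw [min_eq_right h]
    refine (norm_secDiff_le_of_lipschitz (r := ‖z‖ + 1) (L := L)
      (fun y _ => hg.differentiable (by norm_num) y) hL.lipschitzOnWith (by linarith)).trans ?_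
    exact mul_le_mul_of_nonneg_right (le_max_right _ _) (by positivity)

theorem exists_integral_norm_secDiff_le (hn : 1 ≤ n) (hs0 : 0 < s) (hs1 : s < 1)
    {g : Euc n → F} (hg : ContDiff ℝ 2 g) (hc : HasCompactSupport g) :
    ∃ C, 0 ≤ C ∧ ∀ x, Integrable (fun z => rker n s z • secDiff g z x) ∧
      ∫ z, ‖rker n s z • secDiff g z x‖ ≤ C * wt n s x := by
  obtain ⟨A, hA0, hA⟩ := exists_norm_secDiff_le hg hc
  obtain ⟨R, hR0, hR⟩ : ∃ R, 0 < R ∧ ∀ x, R ≤ ‖x‖ → g x = 0 := by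
    obtain ⟨R, hR⟩ := hc.isCompact.isBounded.subset_ball 0
    refine ⟨max R 1, by positivity, fun x hx => ?_⟩
    by_contra h
    have := hR (subset_tsupport _ h)
    simp at this
    linarith [le_max_left R 1]
  set M := ∫ z, rker n s z * min 1 (‖z‖ ^ 2) with hM
  have hM0 : 0 ≤ M := integral_nonneg fun z => mul_nonneg (rker_nonneg z) (by positivity)
  have hgi : Integrable g := hg.continuous.integrable_of_hasCompactSupport hc
  have hI : ∀ x, Integrable (fun z => rker n s z • secDiff g z x) := by
    intro x
    refine ((integrable_rker_min hn hs0 hs1).const_mul A).mono' ?_ (Eventually.of_forall fun z => ?_)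
    · exact (measurable_rker.aestronglyMeasurable).smul
        ((continuous_secDiff hg.continuous).comp (by fun_prop : Continuous fun z : Euc n => (z, x))).aestronglyMeasurable
    · rw [norm_smul, Real.norm_of_nonneg (rker_nonneg z)]
      calc rker n s z * ‖secDiff g z x‖ ≤ rker n s z * (A * min 1 (‖z‖ ^ 2)) :=
            mul_le_mul_of_nonneg_left (hA x z) (rker_nonneg z)
        _ = _ := by ring
  set N := (n : ℝ) + 2 * s with hN
  refine ⟨max (A * M * (1 / (2 * R + 2)) ^ (-N)) (2 * (1 / 2 : ℝ) ^ (-N) * ∫ y, ‖g y‖), ?_, fun x => ⟨hI x, ?_⟩⟩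
  · exact le_max_of_le_left (by positivity)
  by_cases hx : ‖x‖ ≤ 2 * R + 1
  · have h1 : ∫ z, ‖rker n s z • secDiff g z x‖ ≤ A * M := by
      rw [hM, ← integral_const_mul]
      refine integral_mono (hI x).norm ((integrable_rker_min hn hs0 hs1).const_mul A) fun z => ?_
      simp only
      rw [norm_smul, Real.norm_of_nonneg (rker_nonneg z)]
      calc rker n s z * ‖secDiff g z x‖ ≤ rker n s z * (A * min 1 (‖z‖ ^ 2)) :=
            mul_le_mul_of_nonneg_left (hA x z) (rker_nonneg z)
        _ = _ := by ring
    have h2 : 1 ≤ (1 / (2 * R + 2)) ^ (-N) * wt n s x := by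
      have := wt_le_wt (n := n) (s := s) hs0 (δ := 1 / (2 * R + 2)) (by positivity) (x := x) (z := 0) ?_
      · rw [← hN] at this
        simpa [wt, -neg_add_rev] using this
      · simp only [norm_zero, add_zero]
        rw [div_mul_eq_mul_div, div_le_one (by positivity)]
        linarith
    calc _ ≤ A * M := h1
      _ ≤ A * M * ((1 / (2 * R + 2)) ^ (-N) * wt n s x) := le_mul_of_one_le_right (by positivity) h2
      _ = A * M * (1 / (2 * R + 2)) ^ (-N) * wt n s x := by ring
      _ ≤ _ := mul_le_mul_of_nonneg_right (le_max_left _ _) (wt_pos x).le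
  · push Not at hx
    have key : ∀ y z : Euc n, ‖x‖ ≤ ‖y‖ + ‖z‖ → rker n s z * ‖g y‖ ≤
        ((1 / 2 : ℝ) ^ (-N) * wt n s x) * ‖g y‖ := by
      intro y z hyz
      by_cases hy : R ≤ ‖y‖
      · simp [hR y hy]
      · push Not at hy
        refine mul_le_mul_of_nonneg_right (rker_le_wt hs0 (by norm_num) ?_) (norm_nonneg _)
        linarith
    have hg1 : Integrable (fun z => ‖g (x + z)‖) := (hgi.comp_add_left x).norm
    have hg2 : Integrable (fun z => ‖g (x - z)‖) := (hgi.comp_sub_left x).norm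
    calc ∫ z, ‖rker n s z • secDiff g z x‖
        ≤ ∫ z, ((1 / 2 : ℝ) ^ (-N) * wt n s x) * (‖g (x + z)‖ + ‖g (x - z)‖) := by
          refine integral_mono (hI x).norm ((hg1.add hg2).const_mul _) fun z => ?_
          simp only
          rw [norm_smul, Real.norm_of_nonneg (rker_nonneg z)]
          have e : ‖secDiff g z x‖ ≤ ‖g (x + z)‖ + ‖g (x - z)‖ := by
            rw [secDiff, hR x (by linarith), smul_zero, zero_sub]
            refine (norm_sub_le _ _).trans ?_
            rw [norm_neg]
          have k1 := key (x + z) z (by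
            have := norm_sub_le (x + z) z; simpa using this)
          have k2 := key (x - z) z (by
            have := norm_add_le (x - z) z; simpa using this)
          have := mul_le_mul_of_nonneg_left e (rker_nonneg (n := n) (s := s) z)
          linarith
      _ = (2 * (1 / 2 : ℝ) ^ (-N) * ∫ y, ‖g y‖) * wt n s x := by
          rw [integral_const_mul, integral_add hg1 hg2,
            integral_add_left_eq_self (fun z => ‖g z‖) x, integral_sub_left_eq_self (fun z => ‖g z‖) volume x]
          ring
      _ ≤ _ := mul_le_mul_of_nonneg_right (le_max_right _ _) (wt_pos x).le

end SecondDifference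

section Bump

variable {n : ℕ} {s : ℝ}

/-- A smooth radially decreasing bump function supported in the closed ball of radius `1/4`. -/
def radBump (n : ℕ) (x : Euc n) : ℝ := Real.smoothTransition (1 - 16 * ‖x‖ ^ 2)

theorem contDiff_radBump (m : ℕ) : ContDiff ℝ m (radBump n) := by
  have h : ContDiff ℝ m (fun x : Euc n => 1 - 16 * ‖x‖ ^ 2) :=
    contDiff_const.sub (contDiff_const.mul (contDiff_norm_sq ℝ))
  exact (Real.smoothTransition.contDiff (n := (m : ℕ∞))).comp h

theorem continuous_radBump : Continuous (radBump n) := (contDiff_radBump 0).continuous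

theorem radBump_nonneg (x : Euc n) : 0 ≤ radBump n x := Real.smoothTransition.nonneg _

theorem radBump_le_one (x : Euc n) : radBump n x ≤ 1 := Real.smoothTransition.le_one _

theorem radBump_zero : radBump n 0 = 1 := by
  simp [radBump]

theorem radBump_eq_zero {x : Euc n} (h : 1 / 4 ≤ ‖x‖) : radBump n x = 0 :=
  Real.smoothTransition.zero_of_nonpos (by nlinarith)

theorem radBump_anti {x y : Euc n} (h : ‖x‖ ≤ ‖y‖) : radBump n y ≤ radBump n x :=
  Real.smoothTransition.monotone (by have := norm_nonneg x; nlinarith)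

theorem radBump_congr {x y : Euc n} (h : ‖x‖ = ‖y‖) : radBump n x = radBump n y := by
  simp [radBump, h]

theorem hasCompactSupport_radBump : HasCompactSupport (radBump n) := by
  refine HasCompactSupport.intro (isCompact_closedBall (0 : Euc n) (1 / 4)) fun x hx => ?_
  refine radBump_eq_zero ?_
  simp only [mem_closedBall, dist_zero_right, not_le] at hx
  exact hx.le

theorem integrable_radBump : Integrable (radBump n) :=
  continuous_radBump.integrable_of_hasCompactSupport hasCompactSupport_radBump

theorem integral_radBump_pos : 0 < ∫ x, radBump n x :=
  continuous_radBump.integral_pos_of_hasCompactSupport_nonneg_nonzero hasCompactSupport_radBump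
    radBump_nonneg (x := 0) (by simp [radBump_zero])

theorem contDiff_iteratedFDeriv_radBump (k m : ℕ) :
    ContDiff ℝ m (iteratedFDeriv ℝ k (radBump n)) :=
  (contDiff_radBump (m + k)).iteratedFDeriv_right (by norm_cast)

theorem hasCompactSupport_iteratedFDeriv_radBump (k : ℕ) :
    HasCompactSupport (iteratedFDeriv ℝ k (radBump n)) :=
  hasCompactSupport_radBump.iteratedFDeriv k

/-- The operator `nlop` applied to the bump function. -/
def psi (n : ℕ) (s : ℝ) : Euc n → ℝ := nlop n s (radBump n)

theorem iteratedFDeriv_smul_secDiff {g : Euc n → ℝ} {k : ℕ} (hg : ContDiff ℝ k g) (c : ℝ)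
    (z x : Euc n) : iteratedFDeriv ℝ k (fun y => c • secDiff g z y) x =
      c • secDiff (iteratedFDeriv ℝ k g) z x := by
  have h1 : ContDiff ℝ k (fun y => g (y + z)) := hg.comp (by fun_prop)
  have h2 : ContDiff ℝ k (fun y => g (y - z)) := hg.comp (by fun_prop)
  have h3 : ContDiff ℝ k (fun y => (2 : ℝ) • g y) := hg.const_smul (2 : ℝ)
  unfold secDiff
  rw [iteratedFDeriv_const_smul_apply' ((h3.sub h1).sub h2).contDiffAt,
    fun_iteratedFDeriv_sub_apply (h3.sub h1).contDiffAt h2.contDiffAt,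
    fun_iteratedFDeriv_sub_apply h3.contDiffAt h1.contDiffAt,
    iteratedFDeriv_const_smul_apply' hg.contDiffAt, iteratedFDeriv_comp_add_right,
    iteratedFDeriv_comp_sub]

theorem psi_smooth (hn : 1 ≤ n) (hs0 : 0 < s) (hs1 : s < 1) (m : ℕ) :
    ContDiff ℝ m (psi n s) ∧ ∀ k ≤ m, ∀ x, iteratedFDeriv ℝ k (psi n s) x =
      nlop n s (iteratedFDeriv ℝ k (radBump n)) x := by
  have hA := fun k => exists_norm_secDiff_le (contDiff_iteratedFDeriv_radBump (n := n) k 2)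
    (hasCompactSupport_iteratedFDeriv_radBump k)
  choose A hA0 hA using hA
  have e : ∀ k (z x : Euc n), iteratedFDeriv ℝ k (fun y => rker n s z • secDiff (radBump n) z y) x =
      rker n s z • secDiff (iteratedFDeriv ℝ k (radBump n)) z x := fun k z x =>
    iteratedFDeriv_smul_secDiff (contDiff_radBump k) _ _ _
  have h1 : ∀ z : Euc n, ContDiff ℝ m (fun y => rker n s z • secDiff (radBump n) z y) := by
    intro z
    have h := contDiff_radBump (n := n) m
    have k1 : ContDiff ℝ m (fun y => radBump n (y + z)) := h.comp (by fun_prop)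
    have k2 : ContDiff ℝ m (fun y => radBump n (y - z)) := h.comp (by fun_prop)
    have k3 : ContDiff ℝ m (fun y => (2 : ℝ) • radBump n y) := h.const_smul (2 : ℝ)
    exact ((k3.sub k1).sub k2).const_smul (rker n s z)
  have h2 : ∀ k ≤ m, ∀ x ∈ (univ : Set (Euc n)), AEStronglyMeasurable
      (fun z => iteratedFDeriv ℝ k (fun y => rker n s z • secDiff (radBump n) z y) x) volume := by
    intro k _ x _
    simp only [e]
    exact (measurable_rker.aestronglyMeasurable).smul ((continuous_secDiff
      (contDiff_iteratedFDeriv_radBump k 0).continuous).comp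
        (by fun_prop : Continuous fun z : Euc n => (z, x))).aestronglyMeasurable
  have h3 : ∀ k ≤ m, Integrable (fun z : Euc n => A k * (rker n s z * min 1 (‖z‖ ^ 2))) :=
    fun k _ => (integrable_rker_min hn hs0 hs1).const_mul _
  have h4 : ∀ k ≤ m, ∀ᵐ z : Euc n, ∀ x ∈ (univ : Set (Euc n)),
      ‖iteratedFDeriv ℝ k (fun y => rker n s z • secDiff (radBump n) z y) x‖ ≤
        A k * (rker n s z * min 1 (‖z‖ ^ 2)) := by
    intro k _
    refine Eventually.of_forall fun z x _ => ?_
    rw [e, norm_smul, Real.norm_of_nonneg (rker_nonneg z)]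
    calc _ ≤ rker n s z * (A k * min 1 (‖z‖ ^ 2)) :=
            mul_le_mul_of_nonneg_left (hA k x z) (rker_nonneg z)
        _ = _ := by ring
  refine ⟨?_, fun k hk x => ?_⟩
  · rw [← contDiffOn_univ]
    exact contDiffOn_integral isOpen_univ h1 h2 h3 h4
  · have := iteratedFDeriv_integral isOpen_univ h1 h2 h3 h4 hk (mem_univ x)
    simp only [e] at this
    exact this

theorem exists_norm_iteratedFDeriv_psi_le (hn : 1 ≤ n) (hs0 : 0 < s) (hs1 : s < 1) (k : ℕ) :
    ∃ C, 0 ≤ C ∧ ∀ x, ‖iteratedFDeriv ℝ k (psi n s) x‖ ≤ C * wt n s x := by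
  obtain ⟨C, hC0, hC⟩ := exists_integral_norm_secDiff_le hn hs0 hs1
    (contDiff_iteratedFDeriv_radBump (n := n) k 2) (hasCompactSupport_iteratedFDeriv_radBump k)
  refine ⟨C, hC0, fun x => ?_⟩
  rw [(psi_smooth hn hs0 hs1 k).2 k le_rfl]
  exact (norm_integral_le_integral_norm _).trans (hC x).2

theorem continuous_psi (hn : 1 ≤ n) (hs0 : 0 < s) (hs1 : s < 1) : Continuous (psi n s) :=
  (psi_smooth hn hs0 hs1 0).1.continuous

theorem exists_abs_psi_le (hn : 1 ≤ n) (hs0 : 0 < s) (hs1 : s < 1) :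
    ∃ C, 0 ≤ C ∧ ∀ x, |psi n s x| ≤ C * wt n s x := by
  obtain ⟨C, hC0, hC⟩ := exists_norm_iteratedFDeriv_psi_le (n := n) hn hs0 hs1 0
  refine ⟨C, hC0, fun x => ?_⟩
  simpa using hC x

theorem psi_congr {x y : Euc n} (h : ‖x‖ = ‖y‖) : psi n s x = psi n s y := by
  set T := (Submodule.span ℝ {x - y})ᗮ.reflection with hT
  have hTx : T x = y := Submodule.reflection_sub h
  have e := T.measurePreserving.integral_comp T.toHomeomorph.measurableEmbedding
    (fun z => rker n s z • secDiff (radBump n) z y)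
  rw [psi, nlop, nlop, ← e]
  refine integral_congr_ae (Eventually.of_forall fun z => ?_)
  have hB : ∀ w : Euc n, radBump n (T w) = radBump n w := fun w => radBump_congr (by simp)
  simp only [secDiff, ← hTx, ← map_add, ← map_sub, hB, rker, T.norm_map]

theorem psi_le (hn : 1 ≤ n) (hs0 : 0 < s) (hs1 : s < 1) {x : Euc n} (hx : 1 / 4 ≤ ‖x‖) :
    psi n s x ≤ -((2 * ∫ y, radBump n y) * wt n s x) := by
  obtain ⟨C, hC0, hC⟩ := exists_integral_norm_secDiff_le (s := s) hn hs0 hs1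
    (contDiff_radBump (n := n) 2) hasCompactSupport_radBump
  have hi := (hC x).1
  have key : ∀ y z : Euc n, ‖z‖ ≤ ‖x‖ + ‖y‖ → (z = 0 → y = x) → wt n s x * radBump n y ≤
      rker n s z * radBump n y := by
    intro y z hyz hz
    by_cases hy : 1 / 4 ≤ ‖y‖
    · simp [radBump_eq_zero hy]
    · push Not at hy
      have hz0 : z ≠ 0 := by
        intro h
        rw [hz h] at hy
        linarith
      refine mul_le_mul_of_nonneg_right ?_ (radBump_nonneg _)
      refine Real.rpow_le_rpow_of_nonpos (norm_pos_iff.2 hz0) (by linarith) ?_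
      have : (0 : ℝ) ≤ n := by positivity
      linarith
  have hg1 : Integrable (fun z => radBump n (x + z)) := (integrable_radBump.comp_add_left x)
  have hg2 : Integrable (fun z => radBump n (x - z)) := (integrable_radBump.comp_sub_left x)
  have h1 : ∫ z, wt n s x * (radBump n (x + z) + radBump n (x - z)) ≤
      ∫ z, -(rker n s z • secDiff (radBump n) z x) := by
    refine integral_mono ((hg1.add hg2).const_mul _) hi.neg fun z => ?_
    simp only [secDiff, radBump_eq_zero hx, smul_eq_mul]
    have k1 := key (x + z) z (by
      have := norm_sub_le (x + z) x
      simp only [add_sub_cancel_left] at this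
      linarith) (by rintro rfl; simp)
    have k2 := key (x - z) z (by
      have := norm_sub_le x (x - z)
      simpa using this) (by rintro rfl; simp)
    linarith
  rw [integral_const_mul, integral_add hg1 hg2, integral_neg,
    integral_add_left_eq_self (fun z => radBump n z) x,
    integral_sub_left_eq_self (fun z => radBump n z) volume x] at h1
  rw [psi, nlop]
  linarith

end Bump

section Duality

variable {n : ℕ} {s : ℝ}

theorem integrable_prod_mul_secDiff (hn : 1 ≤ n) (hs0 : 0 < s) (hs1 : s < 1) {g h : Euc n → ℝ}
    (hg : ContDiff ℝ 2 g) (hc : HasCompactSupport g) (hh : AEStronglyMeasurable h)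
    (hw : Integrable (fun x => h x * wt n s x)) :
    Integrable (fun p : Euc n × Euc n => h p.1 * (rker n s p.2 • secDiff g p.2 p.1))
      (volume.prod volume) := by
  obtain ⟨C, hC0, hC⟩ := exists_integral_norm_secDiff_le hn hs0 hs1 hg hc
  have hm : Measurable (fun p : Euc n × Euc n => rker n s p.2 • secDiff g p.2 p.1) :=
    (measurable_rker.comp measurable_snd).smul
      ((continuous_secDiff hg.continuous).comp continuous_swap).measurable
  have hm' : AEStronglyMeasurable (fun p : Euc n × Euc n =>
      h p.1 * (rker n s p.2 • secDiff g p.2 p.1)) (volume.prod volume) :=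
    hh.comp_fst.mul hm.aestronglyMeasurable
  rw [integrable_prod_iff hm']
  refine ⟨Eventually.of_forall fun x => (hC x).1.const_mul (h x), ?_⟩
  refine (hw.norm.const_mul C).mono' hm'.norm.integral_prod_right' (Eventually.of_forall fun x => ?_)
  simp only [norm_mul (h x)]
  rw [integral_const_mul, norm_mul, norm_norm,
    Real.norm_of_nonneg (integral_nonneg fun _ => norm_nonneg _),
    Real.norm_of_nonneg (wt_pos x).le]
  calc _ ≤ ‖h x‖ * (C * wt n s x) := mul_le_mul_of_nonneg_left (hC x).2 (norm_nonneg _)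
    _ = _ := by ring

theorem integral_mul_nlop (hn : 1 ≤ n) (hs0 : 0 < s) (hs1 : s < 1) {g h : Euc n → ℝ}
    (hg : ContDiff ℝ 2 g) (hc : HasCompactSupport g) (hh : AEStronglyMeasurable h)
    (hw : Integrable (fun x => h x * wt n s x)) :
    Integrable (fun x => h x * nlop n s g x) ∧
      ∫ x, h x * nlop n s g x = ∫ z, rker n s z * ∫ x, h x * secDiff g z x := by
  have hp := integrable_prod_mul_secDiff hn hs0 hs1 hg hc hh hw
  have h1 := hp.integral_prod_left
  have h2 := integral_integral_swap (f := fun x z => h x * (rker n s z • secDiff g z x)) hp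
  simp only [integral_const_mul] at h1 h2
  refine ⟨h1, h2.trans (integral_congr_ae (Eventually.of_forall fun z => ?_))⟩
  simp only [smul_eq_mul]
  rw [← integral_const_mul]
  exact integral_congr_ae (Eventually.of_forall fun x => by ring)

theorem integral_add_sub_sub {a b c d : Euc n → ℝ} (ha : Integrable a) (hb : Integrable b)
    (hc : Integrable c) (hd : Integrable d) : ∫ x, (a x + b x - c x - d x) =
      (∫ x, a x) + (∫ x, b x) - (∫ x, c x) - ∫ x, d x := by
  have h1 : Integrable (fun x => a x + b x) := ha.add hb
  have h2 : Integrable (fun x => a x + b x - c x) := h1.sub hc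
  rw [integral_sub h2 hd, integral_sub h1 hc, integral_add ha hb]

theorem integrable_psi (hn : 1 ≤ n) (hs0 : 0 < s) (hs1 : s < 1) : Integrable (psi n s) := by
  obtain ⟨C, hC0, hC⟩ := exists_abs_psi_le (n := n) hn hs0 hs1
  exact ((integrable_wt hs0).const_mul C).mono' (continuous_psi hn hs0 hs1).aestronglyMeasurable
    (Eventually.of_forall hC)

theorem integral_psi (hn : 1 ≤ n) (hs0 : 0 < s) (hs1 : s < 1) : ∫ x, psi n s x = 0 := by
  have h := (integral_mul_nlop hn hs0 hs1 (contDiff_radBump (n := n) 2) hasCompactSupport_radBump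
    (h := fun _ => 1) aestronglyMeasurable_const (by simpa using integrable_wt hs0)).2
  simp only [one_mul] at h
  rw [psi, h]
  refine integral_eq_zero_of_ae (Eventually.of_forall fun z => ?_)
  simp only [secDiff, smul_eq_mul, Pi.zero_apply, mul_eq_zero]
  right
  have hi := integrable_radBump (n := n)
  simp only [two_mul]
  rw [integral_add_sub_sub hi hi (hi.comp_add_right z) (hi.comp_sub_right z),
    integral_add_right_eq_self (fun x => radBump n x), integral_sub_right_eq_self
      (fun x => radBump n x)]
  ring

theorem integral_closedBall_psi_nonneg (hn : 1 ≤ n) (hs0 : 0 < s) (hs1 : s < 1) (R : ℝ) :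
    0 ≤ ∫ x, (closedBall (0 : Euc n) R).indicator 1 x * psi n s x := by
  set h : Euc n → ℝ := (closedBall (0 : Euc n) R).indicator 1 with hh
  have hm : Measurable h := measurable_one.indicator measurableSet_closedBall
  have hb : ∀ x, ‖h x‖ ≤ 1 := fun x => by
    by_cases hx : x ∈ closedBall (0 : Euc n) R <;> simp [hh, hx]
  have hanti : ∀ x y, ‖x‖ ≤ ‖y‖ → h y ≤ h x := fun x y hxy => by
    by_cases hy : y ∈ closedBall (0 : Euc n) R
    · have hx : x ∈ closedBall (0 : Euc n) R := by
        rw [mem_closedBall_zero_iff] at *; linarith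
      simp [hh, hx, hy]
    · simp only [hh, indicator_of_notMem hy]
      exact indicator_nonneg (by simp) _
  have hi := integrable_radBump (n := n)
  have hI : ∀ (a : Euc n → ℝ) (c : Euc n), Integrable a → Integrable (fun x => h (x + c) * a x) :=
    fun a c ha => ha.bdd_mul (hm.comp (measurable_add_const c)).aestronglyMeasurable
      (c := 1) (Eventually.of_forall fun x => hb _)
  rw [psi, (integral_mul_nlop hn hs0 hs1 (contDiff_radBump (n := n) 2) hasCompactSupport_radBump
    hm.aestronglyMeasurable ((integrable_wt hs0).bdd_mul hm.aestronglyMeasurable (c := 1)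
      (Eventually.of_forall hb))).2]
  refine integral_nonneg fun z => mul_nonneg (rker_nonneg z) ?_
  have e1 : ∫ x, h x * radBump n (x - z) = ∫ x, h (x + z) * radBump n x := by
    rw [← integral_add_right_eq_self (fun x => h x * radBump n (x - z)) z]
    simp
  have e2 : ∫ x, h (x + z) * radBump n (x + z) = ∫ x, h x * radBump n x :=
    integral_add_right_eq_self (fun x => h x * radBump n x) z
  have i0 : Integrable (fun x => h x * radBump n x) := by simpa using hI _ 0 hi
  have i1 : Integrable (fun x => h x * radBump n (x + z)) := by
    simpa using hI _ 0 (hi.comp_add_right z)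
  have i2 : Integrable (fun x => h x * radBump n (x - z)) := by
    simpa using hI _ 0 (hi.comp_sub_right z)
  have i3 : Integrable (fun x => h (x + z) * radBump n x) := hI _ z hi
  have i4 : Integrable (fun x => h (x + z) * radBump n (x + z)) := hI _ z (hi.comp_add_right z)
  have e3 : ∫ x, h x * secDiff (radBump n) z x =
      ∫ x, (h x - h (x + z)) * (radBump n x - radBump n (x + z)) := by
    have k1 : ∫ x, h x * secDiff (radBump n) z x = (∫ x, h x * radBump n x) +
        (∫ x, h x * radBump n x) - (∫ x, h x * radBump n (x + z)) -
        ∫ x, h x * radBump n (x - z) := by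
      rw [← integral_add_sub_sub i0 i0 i1 i2]
      refine integral_congr_ae (Eventually.of_forall fun x => ?_)
      simp only [secDiff, smul_eq_mul]; ring
    have k2 : ∫ x, (h x - h (x + z)) * (radBump n x - radBump n (x + z)) =
        (∫ x, h x * radBump n x) + (∫ x, h (x + z) * radBump n (x + z)) -
        (∫ x, h x * radBump n (x + z)) - ∫ x, h (x + z) * radBump n x := by
      rw [← integral_add_sub_sub i0 i4 i1 i3]
      refine integral_congr_ae (Eventually.of_forall fun x => ?_)
      ring
    rw [k1, k2, e1, e2]
  rw [e3]
  refine integral_nonneg fun x => ?_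
  rcases le_total ‖x‖ ‖x + z‖ with hx | hx
  · exact mul_nonneg (sub_nonneg.2 (hanti _ _ hx)) (sub_nonneg.2 (radBump_anti hx))
  · exact mul_nonneg_of_nonpos_of_nonpos (sub_nonpos.2 (hanti _ _ hx))
      (sub_nonpos.2 (radBump_anti hx))

end Duality

section Potential

variable {n : ℕ} {s : ℝ}

/-- The radial potential obtained by averaging the dilates of `psi`. -/
def rho (n : ℕ) (s : ℝ) (x : Euc n) : ℝ := ∫ τ in (0 : ℝ)..1, τ ^ (n - 1) * psi n s (τ • x)

theorem continuous_pow_mul_psi (hn : 1 ≤ n) (hs0 : 0 < s) (hs1 : s < 1) (x : Euc n) :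
    Continuous (fun τ : ℝ => τ ^ (n - 1) * psi n s (τ • x)) := by
  have := continuous_psi (n := n) hn hs0 hs1
  fun_prop

theorem integral_pow_mul_psi (hn : 1 ≤ n) (b : ℝ) (x : Euc n) :
    ∫ τ in (0 : ℝ)..b, τ ^ (n - 1) * psi n s (τ • x) = b ^ n * rho n s (b • x) := by
  have h := intervalIntegral.smul_integral_comp_mul_left (a := 0) (b := 1)
    (fun τ : ℝ => τ ^ (n - 1) * psi n s (τ • x)) b
  rw [mul_zero, mul_one] at h
  rw [← h, rho, smul_eq_mul, ← intervalIntegral.integral_const_mul,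
    ← intervalIntegral.integral_const_mul]
  refine intervalIntegral.integral_congr fun τ _ => ?_
  obtain ⟨k, rfl⟩ : ∃ k, n = k + 1 := ⟨n - 1, by omega⟩
  simp only [smul_smul, Nat.add_sub_cancel, mul_comm τ b]
  ring

theorem psi_norm_smul (x y : Euc n) : psi n s (‖y‖ • x) = psi n s (‖x‖ • y) :=
  psi_congr (by simp [norm_smul, mul_comm])

theorem nontrivial_euc (hn : 1 ≤ n) : Nontrivial (Euc n) := by
  have : Nonempty (Fin n) := ⟨⟨0, hn⟩⟩
  infer_instance

theorem integrableOn_pow_mul_psi (hn : 1 ≤ n) (hs0 : 0 < s) (hs1 : s < 1) {x : Euc n}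
    (hx : x ≠ 0) : IntegrableOn (fun τ : ℝ => τ ^ (n - 1) * psi n s (τ • x)) (Ioi 0) := by
  have := nontrivial_euc hn
  have h := (integrable_fun_norm_addHaar (volume : Measure (Euc n))
    (f := fun r => psi n s (r • x))).1 (by
      simp only [psi_norm_smul x]
      exact (integrable_psi hn hs0 hs1).comp_smul (norm_ne_zero_iff.2 hx))
  simpa using h

theorem integral_Ioi_pow_mul_psi (hn : 1 ≤ n) (hs0 : 0 < s) (hs1 : s < 1) (x : Euc n) :
    ∫ τ in Ioi (0 : ℝ), τ ^ (n - 1) * psi n s (τ • x) = 0 := by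
  have := nontrivial_euc hn
  have h := integral_fun_norm_addHaar (volume : Measure (Euc n)) (fun r => psi n s (r • x))
  simp only [psi_norm_smul x] at h
  rw [Measure.integral_comp_smul, integral_psi hn hs0 hs1, smul_zero] at h
  have hv : (volume : Measure (Euc n)).real (ball 0 1) ≠ 0 :=
    (ENNReal.toReal_pos (measure_ball_pos volume _ one_pos).ne' measure_ball_lt_top.ne).ne'
  have hn0 : n ≠ 0 := by omega
  simpa [hv, hn0] using h.symm

theorem rho_nonneg (hn : 1 ≤ n) (hs0 : 0 < s) (hs1 : s < 1) (x : Euc n) : 0 ≤ rho n s x := by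
  rcases eq_or_ne x 0 with rfl | hx
  · refine intervalIntegral.integral_nonneg zero_le_one fun τ hτ => ?_
    refine mul_nonneg (pow_nonneg hτ.1 _) ?_
    rw [smul_zero]
    refine integral_nonneg fun z => mul_nonneg (rker_nonneg z) ?_
    have h1 := radBump_le_one (0 + z)
    have h2 := radBump_le_one (0 - z)
    simp only [secDiff, radBump_zero, smul_eq_mul]
    linarith
  have := nontrivial_euc hn
  have h := integral_fun_norm_addHaar (volume : Measure (Euc n))
    (fun r => (Iic (1 : ℝ)).indicator 1 r * psi n s (r • x))
  have e : ∀ y : Euc n, (Iic (1 : ℝ)).indicator (1 : ℝ → ℝ) ‖y‖ * psi n s (‖y‖ • x) =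
      (closedBall (0 : Euc n) ‖x‖).indicator (1 : Euc n → ℝ) (‖x‖ • y) * psi n s (‖x‖ • y) := by
    intro y
    rw [psi_norm_smul]
    congr 1
    have : ‖x‖ • y ∈ closedBall (0 : Euc n) ‖x‖ ↔ ‖y‖ ∈ Iic (1 : ℝ) := by
      rw [mem_closedBall_zero_iff, norm_smul, norm_norm, mem_Iic]
      exact mul_le_iff_le_one_right (norm_pos_iff.2 hx)
    by_cases hy : ‖y‖ ∈ Iic (1 : ℝ)
    · rw [indicator_of_mem hy, indicator_of_mem (this.2 hy)]; rfl
    · rw [indicator_of_notMem hy, indicator_of_notMem (fun h => hy (this.1 h))]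
  simp only [e] at h
  rw [Measure.integral_comp_smul volume (fun y => (closedBall (0 : Euc n) ‖x‖).indicator 1 y *
    psi n s y)] at h
  have h0 := integral_closedBall_psi_nonneg hn hs0 hs1 ‖x‖
  have hv : 0 < (volume : Measure (Euc n)).real (ball 0 1) :=
    ENNReal.toReal_pos (measure_ball_pos volume _ one_pos).ne' measure_ball_lt_top.ne
  have hn0 : (0 : ℝ) < n := by exact_mod_cast hn
  have e2 : ∫ r in Ioi (0 : ℝ), r ^ (Module.finrank ℝ (Euc n) - 1) •
      ((Iic (1 : ℝ)).indicator 1 r * psi n s (r • x)) = rho n s x := by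
    rw [rho, intervalIntegral.integral_of_le zero_le_one,
      ← integral_indicator measurableSet_Ioi, ← integral_indicator measurableSet_Ioc]
    refine integral_congr_ae (Eventually.of_forall fun r => ?_)
    by_cases h0 : 0 < r <;> by_cases h1 : r ≤ 1 <;> simp [indicator, h0, h1]
  rw [e2] at h
  have h3 : 0 ≤ Module.finrank ℝ (Euc n) • volume.real (ball (0 : Euc n) 1) • rho n s x := by
    rw [← h]
    exact smul_nonneg (abs_nonneg _) h0
  simp only [finrank_euclideanSpace, Fintype.card_fin, nsmul_eq_mul, smul_eq_mul] at h3
  exact nonneg_of_mul_nonneg_right (nonneg_of_mul_nonneg_right h3 hn0) hv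

theorem rho_eq_neg_integral (hn : 1 ≤ n) (hs0 : 0 < s) (hs1 : s < 1) {x : Euc n} (hx : x ≠ 0) :
    rho n s x = -∫ τ in Ioi (1 : ℝ), τ ^ (n - 1) * psi n s (τ • x) := by
  have h := integrableOn_pow_mul_psi (s := s) hn hs0 hs1 hx
  have h1 := intervalIntegral.integral_interval_add_Ioi h (h.mono_set (Ioi_subset_Ioi zero_le_one))
  rw [integral_Ioi_pow_mul_psi hn hs0 hs1 x] at h1
  rw [rho]
  linarith

theorem pow_mul_rpow_neg (hn : 1 ≤ n) {τ : ℝ} (hτ : 0 < τ) :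
    τ ^ (n - 1) * τ ^ (-((n : ℝ) + 2 * s)) = τ ^ (-1 - 2 * s) := by
  rw [← Real.rpow_natCast, ← Real.rpow_add hτ, Nat.cast_sub hn]
  congr 1
  push_cast
  ring

theorem integrableOn_rpow_Ioi_one {a : ℝ} (ha : 0 < a) :
    IntegrableOn (fun τ : ℝ => τ ^ (-1 - a)) (Ioi 1) :=
  integrableOn_Ioi_rpow_of_lt (by linarith) one_pos

theorem integral_rpow_Ioi_one {a : ℝ} (ha : 0 < a) :
    ∫ τ in Ioi (1 : ℝ), τ ^ (-1 - a) = a⁻¹ := by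
  rw [integral_Ioi_rpow_of_lt (by linarith) one_pos, Real.one_rpow,
    show -1 - a + 1 = -a by ring, neg_div_neg_eq, one_div]

theorem exists_le_rho (hn : 1 ≤ n) (hs0 : 0 < s) (hs1 : s < 1) :
    ∃ c, 0 < c ∧ ∀ x : Euc n, 1 ≤ ‖x‖ → c * wt n s x ≤ rho n s x := by
  have hI := integral_radBump_pos (n := n)
  refine ⟨(2 * ∫ x, radBump n x) * (2 * s)⁻¹, by positivity, fun x hx => ?_⟩
  have hx0 : x ≠ 0 := by
    rintro rfl
    simp at hx
    linarith
  rw [rho_eq_neg_integral hn hs0 hs1 hx0, ← integral_rpow_Ioi_one (by positivity : 0 < 2 * s),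
    mul_assoc, mul_comm (∫ τ in _, _) _, ← mul_assoc, ← integral_const_mul, ← integral_neg]
  refine setIntegral_mono_on ((integrableOn_rpow_Ioi_one (by positivity)).const_mul _)
    ((integrableOn_pow_mul_psi (s := s) hn hs0 hs1 hx0).mono_set (Ioi_subset_Ioi zero_le_one)).neg
    measurableSet_Ioi fun τ hτ => ?_
  have hτ1 : (1 : ℝ) < τ := hτ
  have hτ0 : 0 < τ := by linarith
  have hnorm : ‖τ • x‖ = τ * ‖x‖ := by rw [norm_smul, Real.norm_of_nonneg hτ0.le]
  have h1 := psi_le (x := τ • x) hn hs0 hs1 (by rw [hnorm]; nlinarith)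
  have h2 : τ ^ (-((n : ℝ) + 2 * s)) * wt n s x ≤ wt n s (τ • x) := by
    unfold wt
    rw [← Real.mul_rpow hτ0.le (by positivity), hnorm]
    refine Real.rpow_le_rpow_of_nonpos (by positivity) (by linarith) ?_
    have : (0 : ℝ) ≤ n := by positivity
    linarith
  have h3 : (2 * ∫ x, radBump n x) * (τ ^ (-((n : ℝ) + 2 * s)) * wt n s x) ≤
      -psi n s (τ • x) :=
    (mul_le_mul_of_nonneg_left h2 (by positivity)).trans (by linarith)
  rw [← pow_mul_rpow_neg hn hτ0]
  calc _ = τ ^ (n - 1) * ((2 * ∫ x, radBump n x) * (τ ^ (-((n : ℝ) + 2 * s)) * wt n s x)) := by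
        ring
    _ ≤ τ ^ (n - 1) * (-psi n s (τ • x)) := mul_le_mul_of_nonneg_left h3 (by positivity)
    _ = _ := by ring

end Potential

section PotentialDecay

variable {n : ℕ} {s : ℝ}

theorem rho_smooth (hn : 1 ≤ n) (hs0 : 0 < s) (hs1 : s < 1) (m : ℕ) :
    ContDiff ℝ m (rho n s) ∧ ∀ k ≤ m, ∀ x, iteratedFDeriv ℝ k (rho n s) x =
      ∫ τ in Ioc (0 : ℝ) 1, (τ ^ (n - 1) * τ ^ k) • iteratedFDeriv ℝ k (psi n s) (τ • x) := by
  choose C hC0 hC using exists_norm_iteratedFDeriv_psi_le (n := n) hn hs0 hs1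
  have hψ := fun k => (psi_smooth (n := n) hn hs0 hs1 k).1
  have e : ∀ k (τ : ℝ) (x : Euc n), iteratedFDeriv ℝ k (fun y => τ ^ (n - 1) • psi n s (τ • y)) x =
      (τ ^ (n - 1) * τ ^ k) • iteratedFDeriv ℝ k (psi n s) (τ • x) := by
    intro k τ x
    have h1 : ContDiff ℝ k (fun y => psi n s (τ • y)) := (hψ k).comp (by fun_prop)
    rw [iteratedFDeriv_const_smul_apply' h1.contDiffAt, iteratedFDeriv_comp_const_smul _ (hψ k),
      smul_smul]
  have h1 : ∀ τ : ℝ, ContDiff ℝ m (fun y : Euc n => τ ^ (n - 1) • psi n s (τ • y)) := fun τ => by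
    have : ContDiff ℝ m (fun y => psi n s (τ • y)) := (hψ m).comp (by fun_prop)
    exact this.const_smul (τ ^ (n - 1))
  have h2 : ∀ k ≤ m, ∀ x ∈ (univ : Set (Euc n)), AEStronglyMeasurable
      (fun τ : ℝ => iteratedFDeriv ℝ k (fun y => τ ^ (n - 1) • psi n s (τ • y)) x)
      (volume.restrict (Ioc 0 1)) := by
    intro k _ x _
    simp only [e]
    have := (hψ k).continuous_iteratedFDeriv (m := k) le_rfl
    exact Continuous.aestronglyMeasurable (by fun_prop)
  have h3 : ∀ k ≤ m, Integrable (fun _ : ℝ => C k) (volume.restrict (Ioc 0 1)) :=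
    fun k _ => integrable_const _
  have h4 : ∀ k ≤ m, ∀ᵐ τ : ℝ ∂(volume.restrict (Ioc 0 1)), ∀ x ∈ (univ : Set (Euc n)),
      ‖iteratedFDeriv ℝ k (fun y => τ ^ (n - 1) • psi n s (τ • y)) x‖ ≤ C k := by
    intro k _
    filter_upwards [ae_restrict_mem measurableSet_Ioc] with τ hτ x _
    rw [e, norm_smul, ← pow_add, norm_pow, Real.norm_of_nonneg hτ.1.le]
    calc _ ≤ 1 * (C k * 1) := mul_le_mul (pow_le_one₀ hτ.1.le hτ.2)
            ((hC k _).trans (mul_le_mul_of_nonneg_left (wt_le_one hs0 _) (hC0 k)))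
            (norm_nonneg _) zero_le_one
      _ = C k := by ring
  have hr : rho n s = fun x => ∫ τ in Ioc (0 : ℝ) 1, τ ^ (n - 1) • psi n s (τ • x) := by
    funext x
    rw [rho, intervalIntegral.integral_of_le zero_le_one]
    rfl
  refine ⟨?_, fun k hk x => ?_⟩
  · rw [← contDiffOn_univ, hr]
    exact contDiffOn_integral isOpen_univ h1 h2 h3 h4
  · rw [hr, iteratedFDeriv_integral isOpen_univ h1 h2 h3 h4 hk (mem_univ x)]
    simp only [e]

theorem continuous_rho (hn : 1 ≤ n) (hs0 : 0 < s) (hs1 : s < 1) : Continuous (rho n s) :=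
  (rho_smooth hn hs0 hs1 0).1.continuous

theorem exists_rho_le (hn : 1 ≤ n) (hs0 : 0 < s) (hs1 : s < 1) :
    ∃ C, 0 ≤ C ∧ ∀ x : Euc n, rho n s x ≤ C * wt n s x := by
  obtain ⟨C, hC0, hC⟩ := exists_abs_psi_le (n := n) hn hs0 hs1
  set c : ℝ := (1 / 2 : ℝ) ^ (-((n : ℝ) + 2 * s)) with hc
  have hc0 : 0 ≤ c := by positivity
  refine ⟨C * c * 1 + C * c * (2 * s)⁻¹, by positivity, fun x => ?_⟩
  rw [add_mul]
  have hw := (wt_pos (n := n) (s := s) x).le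
  rcases le_or_gt ‖x‖ 1 with hx | hx
  · refine le_add_of_le_of_nonneg ?_ (by positivity)
    have h1 : rho n s x ≤ C := by
      have := intervalIntegral.norm_integral_le_of_norm_le_const (a := (0 : ℝ)) (b := 1)
        (f := fun τ => τ ^ (n - 1) * psi n s (τ • x)) (C := C) (by
          intro τ hτ
          rw [uIoc_of_le zero_le_one] at hτ
          rw [norm_mul, norm_pow, Real.norm_of_nonneg hτ.1.le]
          calc _ ≤ 1 * (C * 1) := mul_le_mul (pow_le_one₀ hτ.1.le hτ.2)
                ((hC _).trans (mul_le_mul_of_nonneg_left (wt_le_one hs0 _) hC0))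
                (abs_nonneg _) zero_le_one
            _ = C := by ring)
      refine (Real.le_norm_self _).trans ?_
      simpa [rho] using this
    have h2 : (1 : ℝ) ≤ c * wt n s x := by
      have := wt_le_wt (n := n) (z := 0) (x := x) hs0 (δ := 1 / 2) (by norm_num)
        (by rw [norm_zero]; linarith)
      simpa [wt, hc] using this
    calc rho n s x ≤ C * 1 := by linarith
      _ ≤ C * (c * wt n s x) := mul_le_mul_of_nonneg_left h2 hC0
      _ = _ := by ring
  · refine le_add_of_nonneg_of_le (by positivity) ?_
    have hx0 : x ≠ 0 := by
      rintro rfl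
      simp at hx
      linarith
    rw [rho_eq_neg_integral hn hs0 hs1 hx0, ← integral_rpow_Ioi_one (by positivity : 0 < 2 * s),
      mul_assoc, mul_comm (∫ τ in _, _) _, ← mul_assoc, ← integral_const_mul, ← integral_neg]
    refine setIntegral_mono_on
      ((integrableOn_pow_mul_psi (s := s) hn hs0 hs1 hx0).mono_set (Ioi_subset_Ioi zero_le_one)).neg
      ((integrableOn_rpow_Ioi_one (by positivity)).const_mul _) measurableSet_Ioi fun τ hτ => ?_
    have hτ1 : (1 : ℝ) < τ := hτ
    have hτ0 : 0 < τ := by linarith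
    have h2 : wt n s (τ • x) ≤ τ ^ (-((n : ℝ) + 2 * s)) * c * wt n s x := by
      rw [hc, ← Real.mul_rpow hτ0.le (by norm_num)]
      refine wt_le_wt hs0 (by positivity) ?_
      rw [norm_smul, Real.norm_of_nonneg hτ0.le]
      nlinarith
    rw [← pow_mul_rpow_neg hn hτ0, ← mul_neg]
    calc _ ≤ τ ^ (n - 1) * (C * (τ ^ (-((n : ℝ) + 2 * s)) * c * wt n s x)) :=
          mul_le_mul_of_nonneg_left ((neg_le_abs _).trans ((hC _).trans
            (mul_le_mul_of_nonneg_left h2 hC0))) (by positivity)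
      _ = _ := by ring

theorem exists_norm_iteratedFDeriv_rho_le_of_two_le (hn : 1 ≤ n) (hs0 : 0 < s) (hs1 : s < 1)
    {k : ℕ} (hk : 2 ≤ k) :
    ∃ C, 0 ≤ C ∧ ∀ x, ‖iteratedFDeriv ℝ k (rho n s) x‖ ≤ C * wt n s x := by
  obtain ⟨C, hC0, hC⟩ := exists_norm_iteratedFDeriv_psi_le (n := n) hn hs0 hs1 k
  have hk' : (2 : ℝ) ≤ k := by exact_mod_cast hk
  have hi : IntegrableOn (fun τ : ℝ => τ ^ ((k : ℝ) + (-1 - 2 * s))) (Ioc 0 1) := by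
    rw [← intervalIntegrable_iff_integrableOn_Ioc_of_le zero_le_one]
    exact intervalIntegral.intervalIntegrable_rpow' (by linarith)
  refine ⟨(∫ τ in Ioc (0 : ℝ) 1, τ ^ ((k : ℝ) + (-1 - 2 * s))) * C, ?_, fun x => ?_⟩
  · exact mul_nonneg (setIntegral_nonneg measurableSet_Ioc fun τ hτ =>
      Real.rpow_nonneg hτ.1.le _) hC0
  rw [(rho_smooth hn hs0 hs1 k).2 k le_rfl, mul_assoc, ← integral_mul_const]
  refine norm_integral_le_of_norm_le (hi.mul_const _) ?_
  filter_upwards [ae_restrict_mem measurableSet_Ioc] with τ hτ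
  rw [norm_smul, norm_mul, norm_pow, norm_pow, Real.norm_of_nonneg hτ.1.le, Real.rpow_add hτ.1,
    ← pow_mul_rpow_neg hn hτ.1, Real.rpow_natCast]
  have := hτ.1
  calc _ ≤ τ ^ (n - 1) * τ ^ k * (C * (τ ^ (-((n : ℝ) + 2 * s)) * wt n s x)) :=
        mul_le_mul_of_nonneg_left ((hC _).trans (mul_le_mul_of_nonneg_left
          (wt_smul_le hs0 hτ.1 hτ.2 x) hC0)) (by positivity)
    _ = _ := by ring

theorem exists_norm_fderiv_rho_le (hn : 1 ≤ n) (hs0 : 0 < s) (hs1 : s < 1) :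
    ∃ C, 0 ≤ C ∧ ∀ x, ‖fderiv ℝ (rho n s) x‖ ≤ C * wt n s x := by
  obtain ⟨C, hC0, hC⟩ := exists_rho_le (n := n) hn hs0 hs1
  obtain ⟨D, hD0, hD⟩ := exists_norm_iteratedFDeriv_rho_le_of_two_le (n := n) hn hs0 hs1 le_rfl
  set c : ℝ := (1 / 3 : ℝ) ^ (-((n : ℝ) + 2 * s)) with hc
  have hc0 : 0 ≤ c := by positivity
  refine ⟨D * c + C * c + C, by positivity, fun x => ?_⟩
  have hw := (wt_pos (n := n) (s := s) x).le
  have hcomp : ∀ y ∈ ball x 2, wt n s y ≤ c * wt n s x := fun y hy => by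
    refine wt_le_wt hs0 (by norm_num) ?_
    rw [mem_ball, dist_eq_norm] at hy
    have := norm_sub_norm_le x y
    rw [norm_sub_rev] at this
    have := norm_nonneg y
    linarith
  have hsm := (rho_smooth (n := n) hn hs0 hs1 2).1
  have hd : Differentiable ℝ (rho n s) := hsm.differentiable (by norm_num)
  have hd2 : Differentiable ℝ (fderiv ℝ (rho n s)) :=
    (hsm.fderiv_right (m := 1) (by norm_num)).differentiable (by norm_num)
  have hL : LipschitzOnWith (D * (c * wt n s x)).toNNReal (fun y => fderiv ℝ (rho n s) y)
      (ball x 2) := by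
    refine (convex_ball x 2).lipschitzOnWith_of_nnnorm_fderiv_le (𝕜 := ℝ) (fun y _ => hd2 y)
      fun y hy => ?_
    rw [← NNReal.coe_le_coe, coe_nnnorm, Real.coe_toNNReal _ (by positivity),
      ← norm_iteratedFDeriv_one, norm_iteratedFDeriv_fderiv]
    exact (hD y).trans (mul_le_mul_of_nonneg_left (hcomp y hy) hD0)
  refine ContinuousLinearMap.opNorm_le_of_unit_norm (by positivity) fun v hv => ?_
  have h1 := norm_taylor_le (fun y _ => hd y) hL (z := v) (by rw [hv]; norm_num)
  rw [hv, Real.coe_toNNReal _ (by positivity), one_pow, mul_one] at h1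
  have h2 := hC x
  have h3 := (hC (x + v)).trans (mul_le_mul_of_nonneg_left (hcomp (x + v) (by
    rw [mem_ball, dist_eq_norm, add_sub_cancel_left, hv]; norm_num)) hC0)
  have h4 := rho_nonneg (n := n) hn hs0 hs1 x
  have h5 := rho_nonneg (n := n) hn hs0 hs1 (x + v)
  rw [Real.norm_eq_abs] at h1 ⊢
  have h6 : 0 ≤ C * (c * wt n s x) := by positivity
  have h7 : 0 ≤ C * wt n s x := by positivity
  have := abs_le.1 h1
  rw [abs_le]
  constructor <;> linarith

theorem exists_norm_iteratedFDeriv_rho_le (hn : 1 ≤ n) (hs0 : 0 < s) (hs1 : s < 1) (k : ℕ) :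
    ∃ C, 0 ≤ C ∧ ∀ x, ‖iteratedFDeriv ℝ k (rho n s) x‖ ≤ C * wt n s x := by
  match k with
  | 0 =>
    obtain ⟨C, hC0, hC⟩ := exists_rho_le (n := n) hn hs0 hs1
    refine ⟨C, hC0, fun x => ?_⟩
    rw [norm_iteratedFDeriv_zero, Real.norm_of_nonneg (rho_nonneg hn hs0 hs1 x)]
    exact hC x
  | 1 =>
    simp only [norm_iteratedFDeriv_one]
    exact exists_norm_fderiv_rho_le hn hs0 hs1
  | k + 2 => exact exists_norm_iteratedFDeriv_rho_le_of_two_le hn hs0 hs1 (by omega)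

theorem integrable_rho (hn : 1 ≤ n) (hs0 : 0 < s) (hs1 : s < 1) : Integrable (rho n s) := by
  obtain ⟨C, hC0, hC⟩ := exists_rho_le (n := n) hn hs0 hs1
  refine ((integrable_wt hs0).const_mul C).mono' (continuous_rho hn hs0 hs1).aestronglyMeasurable
    (Eventually.of_forall fun x => ?_)
  rw [Real.norm_of_nonneg (rho_nonneg hn hs0 hs1 x)]
  exact hC x

theorem integral_rho_pos (hn : 1 ≤ n) (hs0 : 0 < s) (hs1 : s < 1) :
    0 < ∫ x, rho n s x := by
  obtain ⟨c, hc0, hc⟩ := exists_le_rho (n := n) hn hs0 hs1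
  have := nontrivial_euc hn
  obtain ⟨v, hv⟩ := exists_norm_eq (Euc n) zero_le_one
  refine integral_pos_of_integrable_nonneg_nonzero (continuous_rho hn hs0 hs1)
    (integrable_rho hn hs0 hs1) (rho_nonneg hn hs0 hs1) (x := v) ?_
  exact ((mul_pos hc0 (wt_pos v)).trans_le (hc v hv.ge)).ne'

end PotentialDecay

section LocalRegularity

variable {n : ℕ} {s : ℝ} {u : Euc n → ℝ}

theorem C11LocOn.continuous (hu : C11LocOn n u univ) : Continuous u := by
  rw [continuous_iff_continuousAt]
  intro x
  obtain ⟨ε, hε, -, hd, -⟩ := hu x (mem_univ x)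
  exact (hd.continuousOn).continuousAt (ball_mem_nhds x hε)

theorem MemL2s.integrable_mul_wt (hn : 1 ≤ n) (hs : 0 < s) (hu : MemL2s n s u) :
    Integrable (fun x => u x * wt n s x) := by
  refine hu.2.mono' (hu.1.aestronglyMeasurable.mul continuous_wt.aestronglyMeasurable)
    (Eventually.of_forall fun x => ?_)
  have hN : (1 : ℝ) ≤ (n : ℝ) + 2 * s := by
    have : (1 : ℝ) ≤ n := by exact_mod_cast hn
    linarith
  rw [norm_mul, Real.norm_eq_abs, Real.norm_of_nonneg (wt_pos x).le, div_eq_mul_inv, wt,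
    Real.rpow_neg (by positivity)]
  have := Real.add_rpow_le_rpow_add zero_le_one (norm_nonneg x) hN
  rw [Real.one_rpow] at this
  gcongr

theorem C11LocOn.exists_secDiff_le (hu : C11LocOn n u univ) {K : Set (Euc n)} (hK : IsCompact K) :
    ∃ δ, 0 < δ ∧ ∃ L, 0 ≤ L ∧ ∀ x ∈ K, ∀ z, ‖z‖ < δ → ‖secDiff u z x‖ ≤ L * ‖z‖ ^ 2 := by
  refine hK.induction_on (p := fun K => ∃ δ, 0 < δ ∧ ∃ L, 0 ≤ L ∧ ∀ x ∈ K, ∀ z, ‖z‖ < δ →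
    ‖secDiff u z x‖ ≤ L * ‖z‖ ^ 2) ⟨1, one_pos, 0, le_rfl, by simp⟩ ?_ ?_ ?_
  · rintro A B hAB ⟨δ, hδ, L, hL, h⟩
    exact ⟨δ, hδ, L, hL, fun x hx => h x (hAB hx)⟩
  · rintro A B ⟨δ, hδ, L, hL, h⟩ ⟨δ', hδ', L', hL', h'⟩
    refine ⟨min δ δ', lt_min hδ hδ', max L L', le_max_of_le_left hL, fun x hx z hz => ?_⟩
    rcases hx with hx | hx
    · exact (h x hx z (hz.trans_le (min_le_left _ _))).trans (by gcongr; exact le_max_left _ _)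
    · exact (h' x hx z (hz.trans_le (min_le_right _ _))).trans (by gcongr; exact le_max_right _ _)
  · intro x _
    obtain ⟨ε, hε, -, hd, L, hL⟩ := hu x (mem_univ x)
    refine ⟨ball x (ε / 2), mem_nhdsWithin_of_mem_nhds (ball_mem_nhds x (by positivity)), ε / 2,
      by positivity, 2 * L, by positivity, fun y hy z hz => ?_⟩
    have hsub : ball y (ε / 2) ⊆ ball x ε := ball_subset_ball' (by
      rw [mem_ball] at hy; linarith)
    refine norm_secDiff_le_of_lipschitz (fun w hw => ?_) (hL.mono hsub) hz
    exact (hd.differentiableOn (by norm_num)).differentiableAt (isOpen_ball.mem_nhds (hsub hw))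

theorem rker_le_mul_min {δ : ℝ} (hδ : 0 < δ) {z : Euc n} (hz : δ ≤ ‖z‖) :
    rker n s z ≤ (min 1 (δ ^ 2))⁻¹ * (rker n s z * min 1 (‖z‖ ^ 2)) := by
  have h0 : 0 < min 1 (δ ^ 2) := lt_min one_pos (by positivity)
  have h : min 1 (δ ^ 2) ≤ min 1 (‖z‖ ^ 2) := by gcongr
  have hk := rker_nonneg (n := n) (s := s) z
  rw [inv_mul_eq_div, le_div_iff₀ h0]
  gcongr

theorem exists_rker_le_wt_add (n : ℕ) (hs : 0 < s) {δ : ℝ} (hδ : 0 < δ) (R : ℝ) : ∃ c, 0 ≤ c ∧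
    ∀ x z : Euc n, ‖x‖ ≤ R → δ ≤ ‖z‖ → rker n s z ≤ c * wt n s (x + z) := by
  have h0 : 0 < δ / (1 + |R| + δ) := by positivity
  refine ⟨(δ / (1 + |R| + δ)) ^ (-((n : ℝ) + 2 * s)), by positivity, fun x z hx hz => ?_⟩
  refine rker_le_wt hs h0 ?_
  rw [div_mul_eq_mul_div, div_le_iff₀ (by positivity)]
  have h1 := norm_add_le x z
  have h2 := le_abs_self R
  nlinarith [abs_nonneg R]

theorem exists_integral_norm_rker_mul_secDiff_le (hn : 1 ≤ n) (hs0 : 0 < s) (hs1 : s < 1)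
    (hu : C11LocOn n u univ) (hu2 : MemL2s n s u) {K : Set (Euc n)} (hK : IsCompact K) :
    ∃ M, ∀ x ∈ K, Integrable (fun z => rker n s z * secDiff u z x) ∧
      ∫ z, ‖rker n s z * secDiff u z x‖ ≤ M := by
  obtain ⟨δ₀, hδ₀, L, hL, h⟩ := hu.exists_secDiff_le hK
  obtain ⟨δ, hδ, hδ1, hδ2⟩ : ∃ δ : ℝ, 0 < δ ∧ δ ≤ δ₀ ∧ δ ≤ 1 :=
    ⟨min δ₀ 1, lt_min hδ₀ one_pos, min_le_left _ _, min_le_right _ _⟩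
  obtain ⟨B, hB⟩ := hK.exists_bound_of_continuousOn hu.continuous.continuousOn
  obtain ⟨R, hR⟩ := hK.isBounded.exists_norm_le
  obtain ⟨c, hc0, hc⟩ := exists_rker_le_wt_add n hs0 hδ R
  have hw := (hu2.integrable_mul_wt hn hs0).norm
  set A := L + 2 * |B| * (min 1 (δ ^ 2))⁻¹ with hA
  have hA0 : 0 ≤ A := by positivity
  have hI := integrable_rker_min hn hs0 hs1
  refine ⟨A * (∫ z, rker n s z * min 1 (‖z‖ ^ 2)) + c * (∫ x, ‖u x * wt n s x‖) +
    c * (∫ x, ‖u x * wt n s x‖), fun x hx => ?_⟩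
  have i1 := (hw.comp_add_left x).const_mul c
  have i2 := (hw.comp_sub_left x).const_mul c
  have i3 := hI.const_mul A
  have hbd : ∀ z, ‖rker n s z * secDiff u z x‖ ≤ A * (rker n s z * min 1 (‖z‖ ^ 2)) +
      c * ‖u (x + z) * wt n s (x + z)‖ + c * ‖u (x - z) * wt n s (x - z)‖ := by
    intro z
    have hk := rker_nonneg (n := n) (s := s) z
    have hm : 0 ≤ min 1 (‖z‖ ^ 2) := by positivity
    rw [norm_mul, Real.norm_of_nonneg hk, norm_mul (u (x + z)), norm_mul (u (x - z)),
      Real.norm_of_nonneg (wt_pos _).le, Real.norm_of_nonneg (wt_pos _).le]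
    have hw1 := wt_pos (n := n) (s := s) (x + z)
    have hw2 := wt_pos (n := n) (s := s) (x - z)
    rcases lt_or_ge ‖z‖ δ with hz | hz
    · have h1 := h x hx z (hz.trans_le hδ1)
      have h2 : min 1 (‖z‖ ^ 2) = ‖z‖ ^ 2 := min_eq_right (by
        have := norm_nonneg z
        nlinarith)
      have h3 : L ≤ A := by
        rw [hA]
        exact le_add_of_nonneg_right (by positivity)
      have h4 : rker n s z * ‖secDiff u z x‖ ≤ A * (rker n s z * min 1 (‖z‖ ^ 2)) := by
        rw [h2]
        calc _ ≤ rker n s z * (A * ‖z‖ ^ 2) := by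
              refine mul_le_mul_of_nonneg_left (h1.trans ?_) hk
              gcongr
          _ = _ := by ring
      have h5 : 0 ≤ c * (‖u (x + z)‖ * wt n s (x + z)) := by positivity
      have h6 : 0 ≤ c * (‖u (x - z)‖ * wt n s (x - z)) := by positivity
      linarith
    · have h1 := hc x z (hR x hx) hz
      have h2 := hc x (-z) (hR x hx) (by rwa [norm_neg])
      rw [rker_neg, ← sub_eq_add_neg] at h2
      have h3 := rker_le_mul_min (n := n) (s := s) hδ hz
      have h4 : ‖secDiff u z x‖ ≤ 2 * |B| + ‖u (x + z)‖ + ‖u (x - z)‖ := by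
        have h5 := norm_sub_le ((2 : ℝ) • u x - u (x + z)) (u (x - z))
        have h6 := norm_sub_le ((2 : ℝ) • u x) (u (x + z))
        have h7 : ‖(2 : ℝ) • u x‖ = 2 * ‖u x‖ := by rw [norm_smul]; norm_num
        have h8 := (hB x hx).trans (le_abs_self B)
        unfold secDiff
        linarith
      have h5 : 2 * |B| * rker n s z ≤ A * (rker n s z * min 1 (‖z‖ ^ 2)) := by
        calc _ ≤ 2 * |B| * ((min 1 (δ ^ 2))⁻¹ * (rker n s z * min 1 (‖z‖ ^ 2))) := by gcongr
          _ = (2 * |B| * (min 1 (δ ^ 2))⁻¹) * (rker n s z * min 1 (‖z‖ ^ 2)) := by ring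
          _ ≤ _ := by
            refine mul_le_mul_of_nonneg_right ?_ (by positivity)
            rw [hA]
            linarith
      have h6 := mul_le_mul_of_nonneg_left h4 hk
      have h7 := mul_le_mul_of_nonneg_left h1 (norm_nonneg (u (x + z)))
      have h8 := mul_le_mul_of_nonneg_left h2 (norm_nonneg (u (x - z)))
      nlinarith
  have hm : AEStronglyMeasurable (fun z => rker n s z * secDiff u z x) :=
    measurable_rker.aestronglyMeasurable.mul ((continuous_secDiff hu.continuous).comp
      (by fun_prop : Continuous fun z : Euc n => (z, x))).aestronglyMeasurable
  have hInt := ((i3.add i1).add i2).mono' hm (Eventually.of_forall hbd)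
  refine ⟨hInt, (integral_mono hInt.norm ((i3.add i1).add i2) hbd).trans_eq ?_⟩
  have e1 : ∫ z, ‖u (x + z) * wt n s (x + z)‖ = ∫ x, ‖u x * wt n s x‖ :=
    integral_add_left_eq_self (fun x => ‖u x * wt n s x‖) x
  have e2 : ∫ z, ‖u (x - z) * wt n s (x - z)‖ = ∫ x, ‖u x * wt n s x‖ :=
    integral_sub_left_eq_self (fun x => ‖u x * wt n s x‖) volume x
  rw [integral_add' (i3.add i1) i2, integral_add' i3 i1, integral_const_mul, integral_const_mul,
    integral_const_mul, e1, e2]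

theorem integral_nlop_mul_comm (hn : 1 ≤ n) (hs0 : 0 < s) (hs1 : s < 1)
    (hu : C11LocOn n u univ) (hu2 : MemL2s n s u) {g : Euc n → ℝ} (hg : ContDiff ℝ 2 g)
    (hc : HasCompactSupport g) :
    Integrable (fun x => u x * nlop n s g x) ∧
      ∫ x, u x * nlop n s g x = ∫ x, g x * nlop n s u x := by
  have huc := hu.continuous
  have hgc := hg.continuous
  obtain ⟨h1, h2⟩ := integral_mul_nlop hn hs0 hs1 hg hc huc.aestronglyMeasurable
    (hu2.integrable_mul_wt hn hs0)
  refine ⟨h1, ?_⟩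
  obtain ⟨M, hM⟩ := exists_integral_norm_rker_mul_secDiff_le hn hs0 hs1 hu hu2 hc.isCompact
  have hgi : Integrable g := hgc.integrable_of_hasCompactSupport hc
  have hInt : ∀ a b : Euc n → ℝ, Continuous a → Continuous b → HasCompactSupport b →
      Integrable (fun x => a x * b x) := fun a b ha hb hb' =>
    (ha.mul hb).integrable_of_hasCompactSupport hb'.mul_left
  have key : ∀ z, ∫ x, u x * secDiff g z x = ∫ x, g x * secDiff u z x := by
    intro z
    have cg1 : HasCompactSupport (fun x => g (x + z)) :=
      hc.comp_homeomorph (Homeomorph.addRight z)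
    have cg2 : HasCompactSupport (fun x => g (x - z)) :=
      hc.comp_homeomorph (Homeomorph.subRight z)
    have i0 := hInt u g huc hgc hc
    have i1 := hInt u (fun x => g (x + z)) huc (by fun_prop) cg1
    have i2 := hInt u (fun x => g (x - z)) huc (by fun_prop) cg2
    have i3 := hInt (fun x => u (x + z)) g (by fun_prop) hgc hc
    have i4 := hInt (fun x => u (x - z)) g (by fun_prop) hgc hc
    have e1 : ∫ x, u x * g (x - z) = ∫ x, u (x + z) * g x := by
      rw [← integral_add_right_eq_self (fun x => u x * g (x - z)) z]
      simp
    have e2 : ∫ x, u x * g (x + z) = ∫ x, u (x - z) * g x := by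
      rw [← integral_sub_right_eq_self (fun x => u x * g (x + z)) z]
      simp
    have k1 := integral_add_sub_sub i0 i0 i1 i2
    have k2 := integral_add_sub_sub i0 i0 i3 i4
    rw [e1, e2] at k1
    have k3 : ∫ x, u x * secDiff g z x =
        ∫ x, (u x * g x + u x * g x - u x * g (x + z) - u x * g (x - z)) :=
      integral_congr_ae (Eventually.of_forall fun x => by simp only [secDiff, smul_eq_mul]; ring)
    have k4 : ∫ x, g x * secDiff u z x =
        ∫ x, (u x * g x + u x * g x - u (x + z) * g x - u (x - z) * g x) :=
      integral_congr_ae (Eventually.of_forall fun x => by simp only [secDiff, smul_eq_mul]; ring)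
    rw [k3, k4, k1, k2]
    ring
  have hm : Measurable (fun p : Euc n × Euc n => g p.1 * (rker n s p.2 * secDiff u p.2 p.1)) :=
    (hgc.measurable.comp measurable_fst).mul ((measurable_rker.comp measurable_snd).mul
      ((continuous_secDiff huc).comp continuous_swap).measurable)
  have hp : Integrable (fun p : Euc n × Euc n => g p.1 * (rker n s p.2 * secDiff u p.2 p.1))
      (volume.prod volume) := by
    rw [integrable_prod_iff hm.aestronglyMeasurable]
    have hz : ∀ x, x ∉ tsupport g → g x = 0 := fun x hx => image_eq_zero_of_notMem_tsupport hx
    refine ⟨Eventually.of_forall fun x => ?_, ?_⟩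
    · by_cases hx : x ∈ tsupport g
      · exact (hM x hx).1.const_mul (g x)
      · simp [hz x hx]
    · refine (hgi.norm.mul_const M).mono' hm.aestronglyMeasurable.norm.integral_prod_right'
        (Eventually.of_forall fun x => ?_)
      simp only [norm_mul (g x)]
      rw [integral_const_mul, norm_mul, norm_norm,
        Real.norm_of_nonneg (integral_nonneg fun _ => norm_nonneg _)]
      by_cases hx : x ∈ tsupport g
      · exact mul_le_mul_of_nonneg_left (hM x hx).2 (norm_nonneg _)
      · simp [hz x hx]
  have h3 := integral_integral_swap (f := fun x z => g x * (rker n s z * secDiff u z x)) hp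
  simp only [integral_const_mul] at h3
  rw [h2]
  simp only [key]
  refine Eq.trans (integral_congr_ae (Eventually.of_forall fun z => ?_)) h3.symm
  simp only
  rw [← integral_const_mul]
  exact integral_congr_ae (Eventually.of_forall fun x => by ring)

end LocalRegularity

section Identity

variable {n : ℕ} {s : ℝ} {u : Euc n → ℝ}

theorem fracC_pos (hs0 : 0 < s) (hs1 : s < 1) : 0 < fracC n s := by
  unfold fracC
  have h1 : 0 < Real.Gamma ((n : ℝ) / 2 + s) := Real.Gamma_pos_of_pos (by positivity)
  have h2 : 0 < Real.Gamma (1 - s) := Real.Gamma_pos_of_pos (by linarith)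
  have := Real.pi_pos
  positivity

theorem integrable_indicator_rker_mul_sub (hn : 1 ≤ n) (hs0 : 0 < s) (hs1 : s < 1)
    (hu : C11LocOn n u univ) (hu2 : MemL2s n s u) (x : Euc n) {ε : ℝ} (hε : 0 < ε) :
    Integrable ({z : Euc n | ε ≤ ‖z‖}.indicator fun z => rker n s z * (u x - u (x + z))) := by
  obtain ⟨c, hc0, hc⟩ := exists_rker_le_wt_add n hs0 hε ‖x‖
  have hS : MeasurableSet {z : Euc n | ε ≤ ‖z‖} := measurableSet_le measurable_const measurable_norm
  have huc := hu.continuous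
  have hm : Measurable ({z : Euc n | ε ≤ ‖z‖}.indicator fun z => rker n s z * (u x - u (x + z))) :=
    (measurable_rker.mul (by fun_prop : Continuous fun z => u x - u (x + z)).measurable).indicator hS
  have i1 := ((integrable_rker_min hn hs0 hs1).const_mul (min 1 (ε ^ 2))⁻¹).const_mul |u x|
  have i2 := ((hu2.integrable_mul_wt hn hs0).norm.comp_add_left x).const_mul c
  have hmin : 0 < min 1 (ε ^ 2) := lt_min one_pos (by positivity)
  refine (i1.add i2).mono' hm.aestronglyMeasurable (Eventually.of_forall fun z => ?_)
  have hk := rker_nonneg (n := n) (s := s) z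
  have hw := wt_pos (n := n) (s := s) (x + z)
  by_cases hz : ε ≤ ‖z‖
  · rw [indicator_of_mem (by exact hz), Pi.add_apply, norm_mul, norm_mul,
      Real.norm_of_nonneg hk, Real.norm_of_nonneg hw.le]
    have h1 := mul_le_mul_of_nonneg_left (rker_le_mul_min (n := n) (s := s) hε hz) (abs_nonneg (u x))
    have h2 := mul_le_mul_of_nonneg_left (hc x z le_rfl hz) (norm_nonneg (u (x + z)))
    have h3 := mul_le_mul_of_nonneg_left (norm_sub_le (u x) (u (x + z))) hk
    rw [Real.norm_eq_abs (u x)] at h3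
    linarith
  · rw [indicator_of_notMem (by exact hz), norm_zero]
    exact add_nonneg (by positivity) (by positivity)

theorem HasFracLapAt.eq_nlop (hn : 1 ≤ n) (hs0 : 0 < s) (hs1 : s < 1)
    (hu : C11LocOn n u univ) (hu2 : MemL2s n s u) {x : Euc n} {v : ℝ}
    (h : HasFracLapAt n s u x v) : v = fracC n s / 2 * nlop n s u x := by
  obtain ⟨M, hM⟩ := exists_integral_norm_rker_mul_secDiff_le hn hs0 hs1 hu hu2
    (isCompact_singleton (x := x))
  have hInt := (hM x rfl).1
  have hS : ∀ ε : ℝ, MeasurableSet {z : Euc n | ε ≤ ‖z‖} := fun ε =>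
    measurableSet_le measurable_const measurable_norm
  have key : ∀ ε : ℝ, 0 < ε →
      ∫ y in {y : Euc n | ε ≤ dist x y}, (u x - u y) / dist x y ^ ((n : ℝ) + 2 * s) =
      1 / 2 * ∫ z, {z : Euc n | ε ≤ ‖z‖}.indicator (fun z => rker n s z * secDiff u z x) z := by
    intro ε hε
    set G := {z : Euc n | ε ≤ ‖z‖}.indicator (fun z => rker n s z * (u x - u (x + z))) with hG
    have hGi : Integrable G := integrable_indicator_rker_mul_sub hn hs0 hs1 hu hu2 x hε
    have e1 : ∫ y in {y : Euc n | ε ≤ dist x y}, (u x - u y) / dist x y ^ ((n : ℝ) + 2 * s) =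
        ∫ z, G z := by
      have hS' : MeasurableSet {y : Euc n | ε ≤ dist x y} :=
        measurableSet_le measurable_const (measurable_const.dist measurable_id)
      rw [← integral_indicator hS', ← integral_add_left_eq_self _ x]
      refine integral_congr_ae (Eventually.of_forall fun z => ?_)
      have hd : dist x (x + z) = ‖z‖ := by rw [dist_eq_norm]; simp
      by_cases hz : ε ≤ ‖z‖
      · simp only [hG]
        rw [indicator_of_mem (by simpa [hd] using hz), indicator_of_mem (by exact hz), hd, rker,
          Real.rpow_neg (norm_nonneg _)]
        ring
      · simp only [hG]
        rw [indicator_of_notMem (by simpa [hd] using hz), indicator_of_notMem (by exact hz)]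
    have e2 : ∫ z, G (-z) = ∫ z, G z := integral_neg_eq_self G volume
    have e3 : ∫ z, (G z + G (-z)) =
        ∫ z, {z : Euc n | ε ≤ ‖z‖}.indicator (fun z => rker n s z * secDiff u z x) z := by
      refine integral_congr_ae (Eventually.of_forall fun z => ?_)
      by_cases hz : ε ≤ ‖z‖
      · simp only [hG]
        rw [indicator_of_mem (by exact hz), indicator_of_mem (by simpa using hz),
          indicator_of_mem (by exact hz), rker_neg, secDiff, smul_eq_mul, ← sub_eq_add_neg]
        ring
      · simp only [hG]
        rw [indicator_of_notMem (by exact hz), indicator_of_notMem (by simpa using hz),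
          indicator_of_notMem (by exact hz), add_zero]
    rw [integral_add hGi hGi.comp_neg, e2] at e3
    rw [e1, ← e3]
    ring
  have hlim : Tendsto (fun ε : ℝ => ∫ z, {z : Euc n | ε ≤ ‖z‖}.indicator
      (fun z => rker n s z * secDiff u z x) z) (𝓝[>] 0) (𝓝 (nlop n s u x)) := by
    refine tendsto_integral_filter_of_dominated_convergence
      (fun z => ‖rker n s z * secDiff u z x‖) ?_ ?_ hInt.norm ?_
    · exact Eventually.of_forall fun ε => hInt.aestronglyMeasurable.indicator (hS ε)
    · exact Eventually.of_forall fun ε => Eventually.of_forall fun z => norm_indicator_le_norm_self _ _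
    · refine Eventually.of_forall fun z => ?_
      rcases eq_or_ne z 0 with rfl | hz
      · refine tendsto_nhds_of_eventually_eq ?_
        refine Eventually.of_forall fun ε => ?_
        have : secDiff u 0 x = 0 := by simp [secDiff, two_mul]
        simp [indicator, this]
      · refine tendsto_nhds_of_eventually_eq ?_
        filter_upwards [Ioo_mem_nhdsGT (norm_pos_iff.2 hz)] with ε hε
        rw [indicator_of_mem (by exact hε.2.le)]
        rfl
  have h2 : Tendsto (fun ε : ℝ => fracC n s * ∫ y in {y : Euc n | ε ≤ dist x y},
      (u x - u y) / dist x y ^ ((n : ℝ) + 2 * s)) (𝓝[>] 0)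
      (𝓝 (fracC n s * (1 / 2 * nlop n s u x))) := by
    refine ((hlim.const_mul (1 / 2)).const_mul (fracC n s)).congr' ?_
    filter_upwards [self_mem_nhdsWithin] with ε hε
    rw [key ε hε]
  rw [tendsto_nhds_unique h h2]
  ring

theorem nlop_comp_smul_sub {σ : ℝ} (hσ : 0 < σ) (x y : Euc n) :
    nlop n s (fun y => radBump n (σ • (x - y))) y = σ ^ (2 * s) * psi n s (σ • (x - y)) := by
  have e : ∀ z : Euc n, rker n s z • secDiff (fun y => radBump n (σ • (x - y))) z y =
      σ ^ ((n : ℝ) + 2 * s) *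
        (rker n s (σ • z) • secDiff (radBump n) (σ • z) (σ • (x - y))) := by
    intro z
    have h1 : rker n s (σ • z) = σ ^ (-((n : ℝ) + 2 * s)) * rker n s z := by
      rw [rker, rker, norm_smul, Real.norm_of_nonneg hσ.le,
        Real.mul_rpow hσ.le (norm_nonneg _)]
    have h2 : σ ^ ((n : ℝ) + 2 * s) * σ ^ (-((n : ℝ) + 2 * s)) = 1 := by
      rw [← Real.rpow_add hσ, add_neg_cancel, Real.rpow_zero]
    have h3 : secDiff (fun y => radBump n (σ • (x - y))) z y =
        secDiff (radBump n) (σ • z) (σ • (x - y)) := by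
      simp only [secDiff]
      rw [← smul_add, ← smul_sub, show x - (y + z) = x - y - z by abel,
        show x - (y - z) = x - y + z by abel]
      ring
    rw [h3, h1, smul_eq_mul, smul_eq_mul, ← mul_assoc, ← mul_assoc, h2, one_mul]
  rw [nlop]
  simp only [e]
  rw [integral_const_mul, Measure.integral_comp_smul volume (fun z => rker n s z •
    secDiff (radBump n) z (σ • (x - y)))]
  rw [finrank_euclideanSpace, Fintype.card_fin, abs_of_nonneg (by positivity), smul_eq_mul,
    ← mul_assoc, Real.rpow_add hσ, Real.rpow_natCast, psi, nlop]
  congr 1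
  field_simp

end Identity

section Representation

variable {n : ℕ} {s : ℝ} {u : Euc n → ℝ}

theorem integral_comp_smul_sub {G : Type*} [NormedAddCommGroup G] [NormedSpace ℝ G]
    (h : Euc n → G) {σ : ℝ} (hσ : 0 < σ) (x : Euc n) :
    ∫ y, h (σ • (x - y)) = (σ ^ n)⁻¹ • ∫ z, h z := by
  rw [integral_sub_left_eq_self (fun z => h (σ • z)) volume x, Measure.integral_comp_smul,
    finrank_euclideanSpace, Fintype.card_fin, abs_of_nonneg (by positivity)]

theorem integrable_comp_smul_sub {G : Type*} [NormedAddCommGroup G]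
    {h : Euc n → G} (hh : Integrable h) {σ : ℝ} (hσ : 0 < σ) (x : Euc n) :
    Integrable (fun y => h (σ • (x - y))) :=
  (hh.comp_smul hσ.ne').comp_sub_left x

/-- The convolution of `F` with a dilation of the bump function. -/
def bumpConv (n : ℕ) (F : Euc n → ℝ) (σ : ℝ) (x : Euc n) : ℝ :=
  ∫ y, F y * (σ ^ n * radBump n (σ • (x - y)))

theorem integral_mul_psi_eq_bumpConv (hn : 1 ≤ n) (hs0 : 0 < s) (hs1 : s < 1)
    (hu : C11LocOn n u univ) (hu2 : MemL2s n s u) {f : Euc n → ℝ}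
    (hf : ∀ x ∈ ball (0 : Euc n) 1, HasFracLapAt n s u x (f x)) {x : Euc n}
    (hx : x ∈ ball (0 : Euc n) (1 / 2)) {σ : ℝ} (hσ : 1 ≤ σ) :
    ∫ y, u y * (σ ^ (n - 1) * psi n s (σ • (x - y))) =
      2 / fracC n s * (σ ^ (-1 - 2 * s) * bumpConv n ((ball 0 1).indicator f) σ x) := by
  have hσ0 : 0 < σ := by linarith
  have hc := fracC_pos (n := n) hs0 hs1
  have hsupp : ∀ y, y ∉ closedBall x (1 / 4) → radBump n (σ • (x - y)) = 0 := fun y hy => by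
    rw [mem_closedBall, dist_eq_norm, not_le, norm_sub_rev] at hy
    refine radBump_eq_zero ?_
    rw [norm_smul, Real.norm_of_nonneg hσ0.le]
    nlinarith
  have hg : ContDiff ℝ 2 (fun y => radBump n (σ • (x - y))) :=
    (contDiff_radBump (n := n) 2).comp (by fun_prop)
  have hgc : HasCompactSupport (fun y => radBump n (σ • (x - y))) :=
    HasCompactSupport.intro (isCompact_closedBall x (1 / 4)) hsupp
  have h := (integral_nlop_mul_comm hn hs0 hs1 hu hu2 hg hgc).2
  simp only [nlop_comp_smul_sub hσ0] at h
  have e1 : ∀ y, radBump n (σ • (x - y)) * nlop n s u y =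
      2 / fracC n s * ((ball (0 : Euc n) 1).indicator f y * radBump n (σ • (x - y))) := by
    intro y
    by_cases hy : y ∈ ball (0 : Euc n) 1
    · rw [indicator_of_mem hy, (hf y hy).eq_nlop hn hs0 hs1 hu hu2]
      field_simp
    · rw [hsupp y, mul_zero, mul_zero, zero_mul]
      intro hy'
      apply hy
      rw [mem_ball_zero_iff] at hx ⊢
      rw [mem_closedBall, dist_eq_norm] at hy'
      have := norm_le_norm_sub_add y x
      linarith
  simp only [e1] at h
  rw [integral_const_mul] at h
  have hpow : σ ^ (n - 1) * σ ^ (-(2 * s)) = σ ^ (-1 - 2 * s) * σ ^ n := by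
    rw [← Real.rpow_natCast, ← Real.rpow_natCast, ← Real.rpow_add hσ0, ← Real.rpow_add hσ0,
      Nat.cast_sub hn]
    congr 1
    push_cast
    ring
  have hinv : σ ^ (-(2 * s)) * σ ^ (2 * s) = 1 := by
    rw [← Real.rpow_add hσ0, neg_add_cancel, Real.rpow_zero]
  have e2 : ∫ y, u y * (σ ^ (n - 1) * psi n s (σ • (x - y))) =
      σ ^ (n - 1) * σ ^ (-(2 * s)) * ∫ y, u y * (σ ^ (2 * s) * psi n s (σ • (x - y))) := by
    rw [← integral_const_mul]
    refine integral_congr_ae (Eventually.of_forall fun y => ?_)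
    simp only
    linear_combination (-u y * σ ^ (n - 1) * psi n s (σ • (x - y))) * hinv
  have e3 : bumpConv n ((ball 0 1).indicator f) σ x =
      σ ^ n * ∫ y, (ball (0 : Euc n) 1).indicator f y * radBump n (σ • (x - y)) := by
    rw [bumpConv, ← integral_const_mul]
    exact integral_congr_ae (Eventually.of_forall fun y => by ring)
  rw [e2, h, e3, hpow]
  ring

theorem wt_smul_le_self (hs : 0 < s) {σ : ℝ} (hσ : 1 ≤ σ) (z : Euc n) :
    wt n s (σ • z) ≤ wt n s z := by
  have h := wt_le_wt (n := n) (s := s) hs one_pos (x := z) (z := σ • z) (by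
    rw [norm_smul, Real.norm_of_nonneg (by linarith)]
    nlinarith [norm_nonneg z])
  simpa using h

theorem exists_wt_sub_le (n : ℕ) (hs : 0 < s) :
    ∃ c, 0 ≤ c ∧ ∀ x y : Euc n, ‖x‖ ≤ 1 → wt n s (x - y) ≤ c * wt n s y :=
  ⟨(1 / 2 : ℝ) ^ (-((n : ℝ) + 2 * s)), by positivity, fun _ y hx => wt_sub_le hs hx y⟩

theorem integrable_mul_rho (hn : 1 ≤ n) (hs0 : 0 < s) (hs1 : s < 1) (huc : Continuous u)
    (hw : Integrable (fun x => u x * wt n s x)) {x : Euc n} (hx : ‖x‖ ≤ 1) {σ : ℝ}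
    (hσ : 1 ≤ σ) : Integrable (fun y => u y * rho n s (σ • (x - y))) := by
  obtain ⟨C, hC0, hC⟩ := exists_rho_le (n := n) hn hs0 hs1
  obtain ⟨c, hc0, hc⟩ := exists_wt_sub_le n hs0
  have hr := continuous_rho (n := n) hn hs0 hs1
  refine (hw.norm.const_mul (C * c)).mono' (Continuous.aestronglyMeasurable (by fun_prop))
    (Eventually.of_forall fun y => ?_)
  rw [norm_mul, norm_mul, Real.norm_of_nonneg (rho_nonneg hn hs0 hs1 _),
    Real.norm_of_nonneg (wt_pos y).le]
  calc _ ≤ ‖u y‖ * (C * (c * wt n s y)) := by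
        refine mul_le_mul_of_nonneg_left ((hC _).trans (mul_le_mul_of_nonneg_left ?_ hC0))
          (norm_nonneg _)
        exact (wt_smul_le_self hs0 hσ _).trans (hc x y hx)
    _ = _ := by ring

theorem integral_mul_rho_sub (hn : 1 ≤ n) (hs0 : 0 < s) (hs1 : s < 1)
    (hu : C11LocOn n u univ) (hu2 : MemL2s n s u) {f : Euc n → ℝ}
    (hf : ∀ x ∈ ball (0 : Euc n) 1, HasFracLapAt n s u x (f x)) {x : Euc n}
    (hx : x ∈ ball (0 : Euc n) (1 / 2)) {b : ℝ} (hb : 1 ≤ b) :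
    (∫ y, u y * (b ^ n * rho n s (b • (x - y)))) - ∫ y, u y * rho n s (x - y) =
      2 / fracC n s * ∫ σ in (1 : ℝ)..b, σ ^ (-1 - 2 * s) *
        bumpConv n ((ball 0 1).indicator f) σ x := by
  have hx1 : ‖x‖ ≤ 1 := by
    rw [mem_ball_zero_iff] at hx
    linarith
  have huc := hu.continuous
  have hw := hu2.integrable_mul_wt hn hs0
  have hψc := continuous_psi (n := n) hn hs0 hs1
  obtain ⟨C, hC0, hC⟩ := exists_abs_psi_le (n := n) hn hs0 hs1
  obtain ⟨c, hc0, hc⟩ := exists_wt_sub_le n hs0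
  have hp : Integrable (fun p : Euc n × ℝ => u p.1 * (p.2 ^ (n - 1) * psi n s (p.2 • (x - p.1))))
      (volume.prod (volume.restrict (Ioc 1 b))) := by
    have h1 : Integrable (fun p : Euc n × ℝ => (b ^ (n - 1) * (C * c)) * ‖u p.1 * wt n s p.1‖)
        (volume.prod (volume.restrict (Ioc 1 b))) := by
      simpa using (hw.norm.const_mul (b ^ (n - 1) * (C * c))).mul_prod
        (integrable_const (μ := volume.restrict (Ioc 1 b)) (1 : ℝ))
    refine h1.mono' (Continuous.aestronglyMeasurable (by fun_prop)) ?_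
    have hmem : ∀ᵐ p : Euc n × ℝ ∂(volume.prod (volume.restrict (Ioc 1 b))), p.2 ∈ Ioc 1 b :=
      Measure.quasiMeasurePreserving_snd.ae (ae_restrict_mem measurableSet_Ioc)
    filter_upwards [hmem] with p hp
    have hp0 : 0 ≤ p.2 := by linarith [hp.1]
    rw [norm_mul, norm_mul, norm_mul, norm_pow, Real.norm_of_nonneg hp0,
      Real.norm_of_nonneg (wt_pos p.1).le]
    calc _ ≤ ‖u p.1‖ * (b ^ (n - 1) * (C * (c * wt n s p.1))) := by
          refine mul_le_mul_of_nonneg_left (mul_le_mul (pow_le_pow_left₀ hp0 hp.2 _) ?_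
            (norm_nonneg _) (by positivity)) (norm_nonneg _)
          refine (hC _).trans (mul_le_mul_of_nonneg_left ?_ hC0)
          exact (wt_smul_le_self hs0 hp.1.le _).trans (hc x p.1 hx1)
      _ = _ := by ring
  have h := integral_integral_swap
    (f := fun y (σ : ℝ) => u y * (σ ^ (n - 1) * psi n s (σ • (x - y)))) hp
  have hcont : ∀ z : Euc n, ∀ a b : ℝ, IntervalIntegrable
      (fun σ : ℝ => σ ^ (n - 1) * psi n s (σ • z)) volume a b := fun z a b =>
    (continuous_pow_mul_psi hn hs0 hs1 z).intervalIntegrable a b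
  have e1 : ∀ y, ∫ σ in Ioc 1 b, u y * (σ ^ (n - 1) * psi n s (σ • (x - y))) =
      u y * (b ^ n * rho n s (b • (x - y))) - u y * rho n s (x - y) := by
    intro y
    rw [← intervalIntegral.integral_of_le hb, intervalIntegral.integral_const_mul,
      ← intervalIntegral.integral_interval_sub_left (hcont _ 0 b) (hcont _ 0 1),
      integral_pow_mul_psi hn, integral_pow_mul_psi hn, one_pow, one_mul, one_smul, mul_sub]
  have e2 : ∫ σ in Ioc 1 b, ∫ y, u y * (σ ^ (n - 1) * psi n s (σ • (x - y))) =
      2 / fracC n s * ∫ σ in (1 : ℝ)..b, σ ^ (-1 - 2 * s) *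
        bumpConv n ((ball 0 1).indicator f) σ x := by
    rw [intervalIntegral.integral_of_le hb, ← integral_const_mul]
    refine setIntegral_congr_fun measurableSet_Ioc fun σ hσ => ?_
    exact integral_mul_psi_eq_bumpConv hn hs0 hs1 hu hu2 hf hx hσ.1.le
  have i1 : Integrable (fun y => u y * (b ^ n * rho n s (b • (x - y)))) := by
    simpa only [mul_left_comm] using
      (integrable_mul_rho hn hs0 hs1 huc hw hx1 hb).const_mul (b ^ n)
  have i2 : Integrable (fun y => u y * rho n s (x - y)) := by
    simpa using integrable_mul_rho hn hs0 hs1 huc hw hx1 le_rfl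
  simp only [e1] at h
  rw [integral_sub i1 i2, e2] at h
  exact h

theorem tendsto_integral_mul_rho (hn : 1 ≤ n) (hs0 : 0 < s) (hs1 : s < 1) (huc : Continuous u)
    (hw : Integrable (fun x => u x * wt n s x)) {x : Euc n} (hx : ‖x‖ ≤ 1) :
    Tendsto (fun b : ℝ => ∫ y, u y * (b ^ n * rho n s (b • (x - y)))) atTop
      (𝓝 (u x * ∫ z, rho n s z)) := by
  set v := (ball x (1 / 2)).indicator u with hv
  have hvm : Measurable v := huc.measurable.indicator measurableSet_ball
  obtain ⟨B, hB⟩ := (isCompact_closedBall x (1 / 2)).exists_bound_of_continuousOn huc.continuousOn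
  have hB0 : 0 ≤ B := (norm_nonneg _).trans (hB x (by simp))
  have hvB : ∀ y, ‖v y‖ ≤ B := fun y => by
    by_cases hy : y ∈ ball x (1 / 2)
    · rw [hv, indicator_of_mem hy]
      exact hB y (ball_subset_closedBall hy)
    · rw [hv, indicator_of_notMem hy, norm_zero]
      exact hB0
  have hρ := integrable_rho (n := n) hn hs0 hs1
  have hρc := continuous_rho (n := n) hn hs0 hs1
  have near : Tendsto (fun b : ℝ => ∫ y, v y * (b ^ n * rho n s (b • (x - y)))) atTop
      (𝓝 (u x * ∫ z, rho n s z)) := by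
    have h1 : Tendsto (fun b : ℝ => ∫ z, v (x - b⁻¹ • z) * rho n s z) atTop
        (𝓝 (∫ z, u x * rho n s z)) := by
      refine tendsto_integral_filter_of_dominated_convergence (fun z => B * rho n s z) ?_ ?_
        (hρ.const_mul B) ?_
      · exact Eventually.of_forall fun b => ((hvm.comp (by fun_prop :
          Measurable fun z : Euc n => x - b⁻¹ • z)).mul hρc.measurable).aestronglyMeasurable
      · refine Eventually.of_forall fun b => Eventually.of_forall fun z => ?_
        rw [norm_mul, Real.norm_of_nonneg (rho_nonneg hn hs0 hs1 z)]
        exact mul_le_mul_of_nonneg_right (hvB _) (rho_nonneg hn hs0 hs1 z)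
      · refine Eventually.of_forall fun z => Tendsto.mul_const _ ?_
        have h2 : Tendsto (fun b : ℝ => x - b⁻¹ • z) atTop (𝓝 x) := by
          have h0 : Tendsto (fun b : ℝ => b⁻¹) atTop (𝓝 0) := tendsto_inv_atTop_zero
          simpa using (h0.smul_const z).const_sub x
        have h3 : Tendsto v (𝓝 x) (𝓝 (u x)) := by
          refine (huc.tendsto x).congr' ?_
          filter_upwards [ball_mem_nhds x (by norm_num : (0 : ℝ) < 1 / 2)] with y hy
          rw [hv, indicator_of_mem hy]
        exact h3.comp h2
    rw [integral_const_mul] at h1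
    refine h1.congr' ?_
    filter_upwards [eventually_gt_atTop 0] with b hb
    have h2 := integral_comp_smul_sub (fun z => v (x - b⁻¹ • z) * rho n s z) hb x
    simp only [smul_smul, inv_mul_cancel₀ hb.ne', one_smul, sub_sub_cancel, smul_eq_mul] at h2
    simp only [mul_left_comm _ (b ^ n)]
    rw [integral_const_mul, h2, ← mul_assoc, mul_inv_cancel₀ (by positivity), one_mul]
  obtain ⟨C, hC0, hC⟩ := exists_rho_le (n := n) hn hs0 hs1
  obtain ⟨c, hc0, hc⟩ := exists_rker_le_wt_add n hs0 (by norm_num : (0 : ℝ) < 1 / 2) 1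
  have far : Tendsto (fun b : ℝ => ∫ y, (u y - v y) * (b ^ n * rho n s (b • (x - y)))) atTop
      (𝓝 0) := by
    have h1 : Tendsto (fun b : ℝ => b ^ (-(2 * s)) * ∫ y, (C * c) * ‖u y * wt n s y‖) atTop
        (𝓝 0) := by
      simpa using (tendsto_rpow_neg_atTop (by positivity : 0 < 2 * s)).mul_const
        (∫ y, (C * c) * ‖u y * wt n s y‖)
    refine squeeze_zero_norm' ?_ h1
    filter_upwards [eventually_gt_atTop 0] with b hb
    rw [← integral_const_mul]
    refine norm_integral_le_of_norm_le ((hw.norm.const_mul _).const_mul _)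
      (Eventually.of_forall fun y => ?_)
    have hb2 := Real.rpow_nonneg hb.le (-(2 * s))
    by_cases hy : y ∈ ball x (1 / 2)
    · rw [hv, indicator_of_mem hy, sub_self, zero_mul, norm_zero]
      positivity
    · rw [hv, indicator_of_notMem hy, sub_zero, norm_mul, norm_mul, norm_mul,
        Real.norm_of_nonneg (rho_nonneg hn hs0 hs1 _), Real.norm_of_nonneg (wt_pos y).le,
        Real.norm_of_nonneg (by positivity : 0 ≤ b ^ n)]
      rw [mem_ball, dist_eq_norm, not_lt] at hy
      have h2 := hc x (y - x) hx hy
      rw [add_sub_cancel] at h2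
      have hyx : 0 < ‖y - x‖ := by linarith
      have h3 : wt n s (b • (x - y)) ≤ b ^ (-((n : ℝ) + 2 * s)) * rker n s (y - x) := by
        rw [wt, rker, ← Real.mul_rpow hb.le (norm_nonneg _), norm_smul, norm_sub_rev,
          Real.norm_of_nonneg hb.le]
        refine Real.rpow_le_rpow_of_nonpos (by positivity) (by linarith) ?_
        have : (0 : ℝ) ≤ n := by positivity
        linarith
      have h4 : b ^ n * b ^ (-((n : ℝ) + 2 * s)) = b ^ (-(2 * s)) := by
        rw [← Real.rpow_natCast, ← Real.rpow_add hb]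
        congr 1
        ring
      have h5 : 0 ≤ b ^ (-((n : ℝ) + 2 * s)) := by positivity
      calc _ ≤ ‖u y‖ * (b ^ n * (C * (b ^ (-((n : ℝ) + 2 * s)) * (c * wt n s y)))) := by
            refine mul_le_mul_of_nonneg_left (mul_le_mul_of_nonneg_left ((hC _).trans
              (mul_le_mul_of_nonneg_left (h3.trans (mul_le_mul_of_nonneg_left h2 h5)) hC0))
              (by positivity)) (norm_nonneg _)
        _ = _ := by
            rw [← h4]
            ring
  have hsum := near.add far
  rw [add_zero] at hsum
  refine hsum.congr' ?_
  filter_upwards [eventually_ge_atTop 1] with b hb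
  have hb0 : 0 < b := by linarith
  have i1 : Integrable (fun y => u y * (b ^ n * rho n s (b • (x - y)))) := by
    simpa only [mul_left_comm] using
      (integrable_mul_rho hn hs0 hs1 huc hw hx hb).const_mul (b ^ n)
  have i2 : Integrable (fun y => v y * (b ^ n * rho n s (b • (x - y)))) :=
    ((integrable_comp_smul_sub hρ hb0 x).const_mul (b ^ n)).bdd_mul hvm.aestronglyMeasurable
      (c := B) (Eventually.of_forall hvB)
  have i3 : Integrable (fun y => (u y - v y) * (b ^ n * rho n s (b • (x - y)))) := by
    simp only [sub_mul]
    exact i1.sub i2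
  rw [← integral_add i2 i3]
  exact integral_congr_ae (Eventually.of_forall fun y => by ring)

end Representation

section BumpConv

variable {n : ℕ} {F : Euc n → ℝ}

theorem contDiff_mul_radBump (m : ℕ) (c σ : ℝ) (y : Euc n) :
    ContDiff ℝ m (fun x : Euc n => c * (σ ^ n * radBump n (σ • (x - y)))) := by
  have h := (contDiff_radBump (n := n) m).comp
    (by fun_prop : ContDiff ℝ m (fun x : Euc n => σ • (x - y)))
  exact contDiff_const.mul (contDiff_const.mul h)

theorem iteratedFDeriv_mul_radBump (k : ℕ) (c σ : ℝ) (x y : Euc n) :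
    iteratedFDeriv ℝ k (fun x : Euc n => c * (σ ^ n * radBump n (σ • (x - y)))) x =
      (c * (σ ^ n * σ ^ k)) • iteratedFDeriv ℝ k (radBump n) (σ • (x - y)) := by
  have h1 : ContDiff ℝ k (fun x : Euc n => radBump n (σ • x)) :=
    (contDiff_radBump k).comp (by fun_prop)
  have h2 : ContDiff ℝ k (fun x : Euc n => radBump n (σ • (x - y))) := h1.comp (by fun_prop)
  have h3 := iteratedFDeriv_comp_sub (𝕜 := ℝ) (f := fun x : Euc n => radBump n (σ • x)) k y x
  rw [iteratedFDeriv_comp_const_smul σ (contDiff_radBump k)] at h3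
  simp only [← mul_assoc, ← smul_eq_mul (a := c * σ ^ n)]
  rw [iteratedFDeriv_const_smul_apply' h2.contDiffAt, h3, smul_smul, smul_eq_mul]

theorem exists_norm_iteratedFDeriv_radBump_le (n k : ℕ) :
    ∃ C, 0 ≤ C ∧ ∀ x, ‖iteratedFDeriv ℝ k (radBump n) x‖ ≤ C := by
  obtain ⟨C, hC⟩ := (hasCompactSupport_iteratedFDeriv_radBump (n := n) k).exists_bound_of_continuous
    (contDiff_iteratedFDeriv_radBump k 0).continuous
  exact ⟨C, (norm_nonneg _).trans (hC 0), hC⟩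

theorem bumpConv_smooth (hF : Integrable F) (σ : ℝ) (m : ℕ) :
    ContDiff ℝ m (bumpConv n F σ) ∧ ∀ k ≤ m, ∀ x, iteratedFDeriv ℝ k (bumpConv n F σ) x =
      ∫ y, (F y * (σ ^ n * σ ^ k)) • iteratedFDeriv ℝ k (radBump n) (σ • (x - y)) := by
  choose C hC0 hC using exists_norm_iteratedFDeriv_radBump_le n
  have hmeas : ∀ k ≤ m, ∀ x ∈ (univ : Set (Euc n)), AEStronglyMeasurable (fun y =>
      iteratedFDeriv ℝ k (fun x : Euc n => F y * (σ ^ n * radBump n (σ • (x - y)))) x) volume := by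
    intro k _ x _
    simp only [iteratedFDeriv_mul_radBump]
    exact (hF.aestronglyMeasurable.mul_const _).smul
      ((contDiff_iteratedFDeriv_radBump k 0).continuous.comp
        (by fun_prop : Continuous fun y : Euc n => σ • (x - y))).aestronglyMeasurable
  have hbound : ∀ k ≤ m, ∀ᵐ y : Euc n, ∀ x ∈ (univ : Set (Euc n)), ‖iteratedFDeriv ℝ k
      (fun x : Euc n => F y * (σ ^ n * radBump n (σ • (x - y)))) x‖ ≤
        ‖F y‖ * (‖σ ^ n * σ ^ k‖ * C k) := by
    refine fun k _ => Eventually.of_forall fun y x _ => ?_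
    rw [iteratedFDeriv_mul_radBump, norm_smul, norm_mul, mul_assoc]
    exact mul_le_mul_of_nonneg_left (mul_le_mul_of_nonneg_left (hC k _) (norm_nonneg _))
      (norm_nonneg _)
  have hb : ∀ k ≤ m, Integrable (fun y => ‖F y‖ * (‖σ ^ n * σ ^ k‖ * C k)) := fun k _ =>
    hF.norm.mul_const _
  refine ⟨contDiffOn_univ.1 (contDiffOn_integral isOpen_univ
    (fun y => contDiff_mul_radBump m (F y) σ y) hmeas hb hbound), fun k hk x => ?_⟩
  refine (iteratedFDeriv_integral isOpen_univ
    (fun y => contDiff_mul_radBump m (F y) σ y) hmeas hb hbound hk (mem_univ x)).trans ?_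
  simp only [iteratedFDeriv_mul_radBump]

theorem stronglyMeasurable_iteratedFDeriv_bumpConv (hFm : Measurable F) (hF : Integrable F)
    (k : ℕ) (x : Euc n) :
    StronglyMeasurable (fun σ => iteratedFDeriv ℝ k (bumpConv n F σ) x) := by
  simp only [(bumpConv_smooth hF _ k).2 k le_rfl]
  refine StronglyMeasurable.integral_prod_right (f := fun (σ : ℝ) (y : Euc n) =>
    (F y * (σ ^ n * σ ^ k)) • iteratedFDeriv ℝ k (radBump n) (σ • (x - y))) ?_
  have h1 : StronglyMeasurable (fun p : ℝ × Euc n => F p.2 * (p.1 ^ n * p.1 ^ k)) :=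
    ((hFm.comp measurable_snd).mul
      (by fun_prop : Measurable fun p : ℝ × Euc n => p.1 ^ n * p.1 ^ k)).stronglyMeasurable
  have h2 : StronglyMeasurable (fun p : ℝ × Euc n =>
      iteratedFDeriv ℝ k (radBump n) (p.1 • (x - p.2))) :=
    ((contDiff_iteratedFDeriv_radBump k 0).continuous.comp
      (by fun_prop : Continuous fun p : ℝ × Euc n => p.1 • (x - p.2))).stronglyMeasurable
  exact h1.smul h2

theorem iteratedFDeriv_radBump_eq_zero {k : ℕ} {x : Euc n} (h : 1 / 4 < ‖x‖) :
    iteratedFDeriv ℝ k (radBump n) x = 0 := by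
  have h1 : radBump n =ᶠ[𝓝 x] fun _ => 0 := by
    filter_upwards [continuous_norm.continuousAt.eventually (lt_mem_nhds h)] with y hy
    exact radBump_eq_zero hy.le
  rw [(h1.iteratedFDeriv (𝕜 := ℝ) k).self_of_nhds]
  exact congrFun iteratedFDeriv_fun_zero x

theorem norm_iteratedFDeriv_bumpConv_le (hF : Integrable F) {σ : ℝ} (hσ : 0 < σ) (k : ℕ)
    {x : Euc n} {A : ℝ} (hA : ∀ y, dist y x ≤ σ⁻¹ / 4 → |F y| ≤ A) :
    ‖iteratedFDeriv ℝ k (bumpConv n F σ) x‖ ≤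
      A * σ ^ k * ∫ z, ‖iteratedFDeriv ℝ k (radBump n) z‖ := by
  have hi : Integrable (fun z => ‖iteratedFDeriv ℝ k (radBump n) z‖) :=
    ((contDiff_iteratedFDeriv_radBump k 0).continuous.integrable_of_hasCompactSupport
      (hasCompactSupport_iteratedFDeriv_radBump k)).norm
  rw [(bumpConv_smooth hF σ k).2 k le_rfl]
  have h1 := integral_comp_smul_sub (fun z => ‖iteratedFDeriv ℝ k (radBump n) z‖) hσ x
  have h2 : A * σ ^ k * ∫ z, ‖iteratedFDeriv ℝ k (radBump n) z‖ =
      ∫ y, A * (σ ^ n * σ ^ k) * ‖iteratedFDeriv ℝ k (radBump n) (σ • (x - y))‖ := by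
    rw [integral_const_mul, h1, smul_eq_mul]
    field_simp
  rw [h2]
  refine norm_integral_le_of_norm_le ((integrable_comp_smul_sub hi hσ x).const_mul _)
    (Eventually.of_forall fun y => ?_)
  rw [norm_smul, norm_mul, Real.norm_of_nonneg (by positivity : 0 ≤ σ ^ n * σ ^ k)]
  by_cases hy : dist y x ≤ σ⁻¹ / 4
  · have := hA y hy
    rw [Real.norm_eq_abs]
    gcongr
  · rw [iteratedFDeriv_radBump_eq_zero, norm_zero, mul_zero, mul_zero]
    rw [not_le, dist_comm, dist_eq_norm] at hy
    rw [norm_smul, Real.norm_of_nonneg hσ.le]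
    have h3 := mul_lt_mul_of_pos_left hy hσ
    rwa [mul_div_assoc', mul_inv_cancel₀ hσ.ne'] at h3

theorem bumpConv_indicator_const (c : ℝ) {σ : ℝ} (hσ : 1 ≤ σ) {x : Euc n}
    (hx : x ∈ ball (0 : Euc n) (1 / 2)) :
    bumpConv n ((ball 0 1).indicator fun _ => c) σ x = c * ∫ z, radBump n z := by
  have hσ0 : 0 < σ := by linarith
  have h1 := integral_comp_smul_sub (radBump n) hσ0 x
  have h2 : bumpConv n ((ball 0 1).indicator fun _ => c) σ x =
      ∫ y, c * σ ^ n * radBump n (σ • (x - y)) := by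
    refine integral_congr_ae (Eventually.of_forall fun y => ?_)
    by_cases hy : y ∈ ball (0 : Euc n) 1
    · simp only [indicator_of_mem hy]
      ring
    · simp only [indicator_of_notMem hy]
      rw [radBump_eq_zero]
      · ring
      · rw [mem_ball_zero_iff] at hx hy
        have h3 := norm_sub_norm_le y x
        rw [norm_smul, Real.norm_of_nonneg hσ0.le, norm_sub_rev]
        nlinarith
  rw [h2, integral_const_mul, h1, smul_eq_mul]
  field_simp

theorem integrable_mul_dilate_radBump (hF : Integrable F) (σ : ℝ) (x : Euc n) :
    Integrable (fun y => F y * (σ ^ n * radBump n (σ • (x - y)))) := by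
  refine hF.mul_bdd (c := |σ ^ n|) ?_ (Eventually.of_forall fun y => ?_)
  · exact (continuous_const.mul (continuous_radBump.comp (by fun_prop))).aestronglyMeasurable
  · rw [norm_mul, Real.norm_of_nonneg (radBump_nonneg _), Real.norm_eq_abs]
    exact mul_le_of_le_one_right (abs_nonneg _) (radBump_le_one _)

theorem bumpConv_add {G : Euc n → ℝ} (hF : Integrable F) (hG : Integrable G) (σ : ℝ)
    (x : Euc n) : bumpConv n (F + G) σ x = bumpConv n F σ x + bumpConv n G σ x := by
  simp only [bumpConv, Pi.add_apply, add_mul]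
  exact integral_add (integrable_mul_dilate_radBump hF σ x) (integrable_mul_dilate_radBump hG σ x)

end BumpConv

section HolderData

variable {n : ℕ} {α K : ℝ} {f : Euc n → ℝ}

theorem HolderBoundOn.nonneg {E : Set (Euc n)} (hf : HolderBoundOn n α f E K) (hE : E.Nonempty) :
    0 ≤ K :=
  let ⟨x, hx⟩ := hE
  (abs_nonneg _).trans (hf.1 x hx)

theorem HolderBoundOn.continuousOn {E : Set (Euc n)} (hα : 0 < α) (hf : HolderBoundOn n α f E K) :
    ContinuousOn f E := by
  intro x hx
  rw [ContinuousWithinAt, tendsto_iff_dist_tendsto_zero]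
  have h : Tendsto (fun y => K * dist y x ^ α) (𝓝[E] x) (𝓝 0) := by
    have h1 : Continuous (fun y => K * dist y x ^ α) :=
      continuous_const.mul ((continuous_id.dist continuous_const).rpow_const fun _ => Or.inr hα.le)
    have h2 := h1.tendsto x
    rw [dist_self, Real.zero_rpow hα.ne', mul_zero] at h2
    exact h2.mono_left nhdsWithin_le_nhds
  refine squeeze_zero' (Eventually.of_forall fun y => dist_nonneg) ?_ h
  filter_upwards [self_mem_nhdsWithin] with y hy
  exact hf.2 y hy x hx

theorem measurable_indicator_ball (hf : ContinuousOn f (ball (0 : Euc n) 1)) :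
    Measurable ((ball (0 : Euc n) 1).indicator f) := by
  classical
  rw [← piecewise_eq_indicator]
  exact hf.measurable_piecewise continuousOn_const measurableSet_ball

theorem integrable_indicator_ball (hf : ContinuousOn f (ball (0 : Euc n) 1))
    (hb : ∀ x ∈ ball (0 : Euc n) 1, |f x| ≤ K) :
    Integrable ((ball (0 : Euc n) 1).indicator f) := by
  rw [integrable_indicator_iff measurableSet_ball]
  have : IsFiniteMeasure (volume.restrict (ball (0 : Euc n) 1)) :=
    ⟨by simpa using measure_ball_lt_top⟩
  exact Integrable.of_bound (hf.aestronglyMeasurable measurableSet_ball) K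
    ((ae_restrict_iff' measurableSet_ball).2 (Eventually.of_forall hb))

theorem HolderBoundOn.abs_bumpConv_le (hα0 : 0 < α)
    (hf : HolderBoundOn n α f (ball (0 : Euc n) 1) K) {σ : ℝ} (hσ : 1 ≤ σ) (x : Euc n) :
    ‖iteratedFDeriv ℝ 0 (bumpConv n ((ball 0 1).indicator f) σ) x‖ ≤
      K * ∫ z, ‖iteratedFDeriv ℝ 0 (radBump n) z‖ := by
  have hK := hf.nonneg ⟨0, by simp⟩
  have h := norm_iteratedFDeriv_bumpConv_le (integrable_indicator_ball (hf.continuousOn hα0) hf.1)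
    (by linarith : 0 < σ) 0 (x := x) (A := K) fun y _ => by
      by_cases hy : y ∈ ball (0 : Euc n) 1
      · rw [indicator_of_mem hy]
        exact hf.1 y hy
      · rwa [indicator_of_notMem hy, abs_zero]
  simpa using h

theorem HolderBoundOn.norm_iteratedFDeriv_bumpConv_le (hα0 : 0 < α)
    (hf : HolderBoundOn n α f (ball (0 : Euc n) 1) K) {σ : ℝ} (hσ : 1 ≤ σ) {k : ℕ} (hk : k ≠ 0)
    {x : Euc n} (hx : x ∈ ball (0 : Euc n) (1 / 2)) :
    ‖iteratedFDeriv ℝ k (bumpConv n ((ball 0 1).indicator f) σ) x‖ ≤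
      K * σ ^ (k - α) * ∫ z, ‖iteratedFDeriv ℝ k (radBump n) z‖ := by
  have hK := hf.nonneg ⟨0, by simp⟩
  have hσ0 : 0 < σ := by linarith
  have hfc := hf.continuousOn hα0
  have hx1 : x ∈ ball (0 : Euc n) 1 := ball_subset_ball (by norm_num) hx
  set G := (ball (0 : Euc n) 1).indicator (fun y => f y - f x) with hG
  have hGi : Integrable G := by
    have h1 := integrable_indicator_ball (f := fun _ : Euc n => f x) continuousOn_const
      (K := |f x|) (fun _ _ => le_rfl)
    have h2 := (integrable_indicator_ball hfc hf.1).sub h1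
    rwa [← indicator_sub'] at h2
  have hc := integrable_indicator_ball (f := fun _ : Euc n => f x) continuousOn_const
    (K := |f x|) (fun _ _ => le_rfl)
  have e1 : (ball (0 : Euc n) 1).indicator f = G + (ball 0 1).indicator (fun _ => f x) := by
    rw [hG, ← indicator_add']
    congr 1
    ext y
    simp
  have e2 : bumpConv n ((ball 0 1).indicator f) σ =ᶠ[𝓝 x]
      fun y => bumpConv n G σ y + f x * ∫ z, radBump n z := by
    filter_upwards [isOpen_ball.mem_nhds hx] with y hy
    rw [e1, bumpConv_add hGi hc, bumpConv_indicator_const _ hσ hy]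
  rw [(e2.iteratedFDeriv (𝕜 := ℝ) k).self_of_nhds,
    fun_iteratedFDeriv_add_apply ((bumpConv_smooth hGi σ k).1).contDiffAt contDiffAt_const,
    iteratedFDeriv_const_of_ne hk, Pi.zero_apply, add_zero]
  refine (_root_.norm_iteratedFDeriv_bumpConv_le hGi hσ0 k (A := K * σ ^ (-α))
    fun y hy => ?_).trans (le_of_eq ?_)
  · by_cases hy1 : y ∈ ball (0 : Euc n) 1
    · rw [hG, indicator_of_mem hy1]
      refine (hf.2 y hy1 x hx1).trans ?_
      rw [Real.rpow_neg hσ0.le, ← Real.inv_rpow hσ0.le]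
      have : dist y x ≤ σ⁻¹ := hy.trans (by have := inv_pos.2 hσ0; linarith)
      gcongr
    · rw [hG, indicator_of_notMem hy1, abs_zero]
      positivity
  · rw [mul_assoc K, ← Real.rpow_add_natCast hσ0.ne', neg_add_eq_sub]

theorem HolderBoundOn.abs_bumpConv_sub_le (hα0 : 0 < α)
    (hf : HolderBoundOn n α f (ball (0 : Euc n) 1) K) {σ : ℝ} (hσ : 1 ≤ σ) {x x' : Euc n}
    (hx : x ∈ ball (0 : Euc n) (1 / 2)) (hx' : x' ∈ ball (0 : Euc n) (1 / 2)) :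
    ‖iteratedFDeriv ℝ 0 (bumpConv n ((ball 0 1).indicator f) σ) x -
      iteratedFDeriv ℝ 0 (bumpConv n ((ball 0 1).indicator f) σ) x'‖ ≤
      K * dist x x' ^ α * ∫ z, ‖iteratedFDeriv ℝ 0 (radBump n) z‖ := by
  have hσ0 : 0 < σ := by linarith
  have hσ1 : σ⁻¹ ≤ 1 := inv_le_one_of_one_le₀ hσ
  set F := (ball (0 : Euc n) 1).indicator f with hF
  have hFi : Integrable F := integrable_indicator_ball (hf.continuousOn hα0) hf.1
  have hTi : Integrable (fun y => F (y + (x' - x))) := hFi.comp_add_right _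
  have e1 : F = (F - fun y => F (y + (x' - x))) + fun y => F (y + (x' - x)) := by simp
  have e2 : bumpConv n (fun y => F (y + (x' - x))) σ x = bumpConv n F σ x' := by
    unfold bumpConv
    rw [← integral_add_right_eq_self (fun y => F y * (σ ^ n * radBump n (σ • (x' - y)))) (x' - x)]
    simp only [sub_add_eq_sub_sub_swap, sub_sub_cancel]
  have e3 : bumpConv n F σ x - bumpConv n F σ x' =
      bumpConv n (F - fun y => F (y + (x' - x))) σ x := by
    conv_lhs => rw [e1, bumpConv_add (hFi.sub hTi) hTi, ← e1, e2]
    ring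
  have h := _root_.norm_iteratedFDeriv_bumpConv_le (hFi.sub hTi) hσ0 0 (x := x)
    (A := K * dist x x' ^ α) fun y hy => by
      rw [mem_ball_zero_iff] at hx hx'
      rw [dist_eq_norm] at hy
      have h1 : y ∈ ball (0 : Euc n) 1 := by
        rw [mem_ball_zero_iff]
        have := norm_le_norm_add_norm_sub' y x
        linarith
      have h2 : y + (x' - x) ∈ ball (0 : Euc n) 1 := by
        rw [mem_ball_zero_iff]
        have := norm_add_le x' (y - x)
        rw [show y + (x' - x) = x' + (y - x) by abel]
        linarith
      rw [Pi.sub_apply, hF, indicator_of_mem h1, indicator_of_mem h2]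
      refine (hf.2 _ h1 _ h2).trans (le_of_eq ?_)
      rw [dist_eq_norm, dist_eq_norm]
      congr 3
      abel
  have e4 : iteratedFDeriv ℝ 0 (bumpConv n F σ) x - iteratedFDeriv ℝ 0 (bumpConv n F σ) x' =
      iteratedFDeriv ℝ 0 (bumpConv n (F - fun y => F (y + (x' - x))) σ) x := by
    ext
    simp only [sub_apply, iteratedFDeriv_zero_apply, e3]
  rw [e4]
  simpa using h

end HolderData

section HigherHolder

variable {n m : ℕ} {β : ℝ} {u v : Euc n → ℝ} {U : Set (Euc n)} {A B : ℝ}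

theorem norm_iteratedFDeriv_sub_le (hu : ContDiff ℝ (m + 1) u) (hU : Convex ℝ U)
    (hA : ∀ x ∈ U, ‖iteratedFDeriv ℝ (m + 1) u x‖ ≤ A) {x y : Euc n} (hx : x ∈ U) (hy : y ∈ U) :
    ‖iteratedFDeriv ℝ m u x - iteratedFDeriv ℝ m u y‖ ≤ A * dist x y := by
  rw [dist_eq_norm]
  refine hU.norm_image_sub_le_of_norm_fderiv_le (𝕜 := ℝ) (fun z _ => ?_)
    (fun z hz => by rw [norm_fderiv_iteratedFDeriv]; exact hA z hz) hy hx
  exact (hu.differentiable_iteratedFDeriv (by exact_mod_cast m.lt_succ_self)) z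

theorem HigherHolderBoundOn.mono (h : HigherHolderBoundOn n m β u U A) (hAB : A ≤ B) :
    HigherHolderBoundOn n m β u U B :=
  ⟨h.1, fun k hk x hx => (h.2.1 k hk x hx).trans hAB, fun x hx y hy =>
    (h.2.2 x hx y hy).trans (mul_le_mul_of_nonneg_right hAB (Real.rpow_nonneg dist_nonneg _))⟩

theorem HigherHolderBoundOn.congr (hU : IsOpen U) (h : HigherHolderBoundOn n m β u U A)
    (huv : EqOn v u U) : HigherHolderBoundOn n m β v U A := by
  have e : ∀ k, ∀ x ∈ U, iteratedFDeriv ℝ k v x = iteratedFDeriv ℝ k u x := fun k x hx =>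
    ((huv.eventuallyEq_of_mem (hU.mem_nhds hx)).iteratedFDeriv (𝕜 := ℝ) k).self_of_nhds
  refine ⟨h.1.congr huv, fun k hk x hx => ?_, fun x hx y hy => ?_⟩
  · rw [e k x hx]
    exact h.2.1 k hk x hx
  · rw [e m x hx, e m y hy]
    exact h.2.2 x hx y hy

theorem HigherHolderBoundOn.add (hU : IsOpen U) (hu : HigherHolderBoundOn n m β u U A)
    (hv : HigherHolderBoundOn n m β v U B) :
    HigherHolderBoundOn n m β (fun x => u x + v x) U (A + B) := by
  have e : ∀ k ≤ m, ∀ x ∈ U, iteratedFDeriv ℝ k (fun x => u x + v x) x =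
      iteratedFDeriv ℝ k u x + iteratedFDeriv ℝ k v x := fun k hk x hx => by
    have hk' : ((k : ℕ) : WithTop ℕ∞) ≤ m := by exact_mod_cast hk
    exact fun_iteratedFDeriv_add_apply ((hu.1.contDiffAt (hU.mem_nhds hx)).of_le hk')
      ((hv.1.contDiffAt (hU.mem_nhds hx)).of_le hk')
  refine ⟨hu.1.add hv.1, fun k hk x hx => ?_, fun x hx y hy => ?_⟩
  · rw [e k hk x hx]
    exact norm_add_le_of_le (hu.2.1 k hk x hx) (hv.2.1 k hk x hx)
  · rw [e m le_rfl x hx, e m le_rfl y hy, add_sub_add_comm, add_mul]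
    exact norm_add_le_of_le (hu.2.2 x hx y hy) (hv.2.2 x hx y hy)

theorem HigherHolderBoundOn.const_mul (hU : IsOpen U) (hu : HigherHolderBoundOn n m β u U A)
    {c : ℝ} (hc : 0 ≤ c) : HigherHolderBoundOn n m β (fun x => c * u x) U (c * A) := by
  have e : ∀ k ≤ m, ∀ x ∈ U, iteratedFDeriv ℝ k (fun x => c * u x) x =
      c • iteratedFDeriv ℝ k u x := fun k hk x hx => by
    have hk' : ((k : ℕ) : WithTop ℕ∞) ≤ m := by exact_mod_cast hk
    exact iteratedFDeriv_const_smul_apply' (𝕜 := ℝ) (R := ℝ) (a := c) (f := u) ((hu.1.contDiffAt (hU.mem_nhds hx)).of_le hk')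
  refine ⟨contDiffOn_const.mul hu.1, fun k hk x hx => ?_, fun x hx y hy => ?_⟩
  · rw [e k hk x hx, norm_smul, Real.norm_of_nonneg hc]
    exact mul_le_mul_of_nonneg_left (hu.2.1 k hk x hx) hc
  · rw [e m le_rfl x hx, e m le_rfl y hy, ← smul_sub, norm_smul, Real.norm_of_nonneg hc, mul_assoc]
    exact mul_le_mul_of_nonneg_left (hu.2.2 x hx y hy) hc

theorem higherHolderBoundOn_integral {T : Type*} [MeasurableSpace T] {μ : Measure T}
    {F : T → Euc n → ℝ} {b : T → ℝ} (hU : IsOpen U) (hF : ∀ t, ContDiff ℝ m (F t))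
    (hmeas : ∀ k ≤ m, ∀ x ∈ U, AEStronglyMeasurable (fun t => iteratedFDeriv ℝ k (F t) x) μ)
    (hb : Integrable b μ) (h : ∀ᵐ t ∂μ, HigherHolderBoundOn n m β (F t) U (b t)) :
    HigherHolderBoundOn n m β (fun x => ∫ t, F t x ∂μ) U (∫ t, b t ∂μ) := by
  have hbd : ∀ k ≤ m, ∀ᵐ t ∂μ, ∀ x ∈ U, ‖iteratedFDeriv ℝ k (F t) x‖ ≤ b t := fun k hk => by
    filter_upwards [h] with t ht using ht.2.1 k hk
  have e : ∀ k ≤ m, ∀ x ∈ U, iteratedFDeriv ℝ k (fun x => ∫ t, F t x ∂μ) x =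
      ∫ t, iteratedFDeriv ℝ k (F t) x ∂μ := fun k hk x hx =>
    iteratedFDeriv_integral (b := fun _ => b) hU hF hmeas (fun _ _ => hb) hbd hk hx
  have hInt : ∀ k ≤ m, ∀ x ∈ U, Integrable (fun t => iteratedFDeriv ℝ k (F t) x) μ :=
    fun k hk x hx => hb.mono' (hmeas k hk x hx) (by
      filter_upwards [hbd k hk] with t ht using ht x hx)
  refine ⟨contDiffOn_integral (b := fun _ => b) hU hF hmeas (fun _ _ => hb) hbd,
    fun k hk x hx => ?_, fun x hx y hy => ?_⟩
  · rw [e k hk x hx]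
    refine norm_integral_le_of_norm_le hb ?_
    filter_upwards [hbd k hk] with t ht using ht x hx
  · rw [e m le_rfl x hx, e m le_rfl y hy, ← integral_sub (hInt m le_rfl x hx) (hInt m le_rfl y hy),
      ← integral_mul_const]
    refine norm_integral_le_of_norm_le (hb.mul_const _) ?_
    filter_upwards [h] with t ht using ht.2.2 x hx y hy

end HigherHolder

section LocalPart

variable {n m : ℕ} {s α β ε K θ : ℝ} {f : Euc n → ℝ}

theorem exists_higherHolderBoundOn_bumpConv (n : ℕ) (hα0 : 0 < α) (hβ0 : 0 ≤ β) (hβ1 : β ≤ 1)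
    (hθ0 : 0 < θ) (hθ : θ = m - α + β) :
    ∃ M, 0 ≤ M ∧ ∀ (f : Euc n → ℝ) (K : ℝ), HolderBoundOn n α f (ball (0 : Euc n) 1) K →
      ∀ σ : ℝ, 1 ≤ σ → HigherHolderBoundOn n m β (bumpConv n ((ball 0 1).indicator f) σ)
        (ball (0 : Euc n) (1 / 2)) (M * K * σ ^ θ) := by
  set I : ℕ → ℝ := fun k => ∫ z, ‖iteratedFDeriv ℝ k (radBump n) z‖ with hI
  have hI0 : ∀ k, 0 ≤ I k := fun k => integral_nonneg fun z => norm_nonneg _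
  set M := 2 * ∑ k ∈ Finset.range (m + 2), I k with hM
  have hM0 : 0 ≤ ∑ k ∈ Finset.range (m + 2), I k := Finset.sum_nonneg fun k _ => hI0 k
  have hIM : ∀ k ≤ m + 1, 2 * I k ≤ M := fun k hk =>
    mul_le_mul_of_nonneg_left (Finset.single_le_sum (fun k _ => hI0 k)
      (Finset.mem_range.2 (Nat.lt_succ_of_le hk))) zero_le_two
  refine ⟨M, by positivity, fun f K hf σ hσ => ?_⟩
  have hK := hf.nonneg ⟨0, by simp⟩
  have hσ0 : 0 < σ := by linarith
  have hFi := integrable_indicator_ball (hf.continuousOn hα0) hf.1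
  have bound : ∀ {k : ℕ} {p q c : ℝ}, k ≤ m + 1 → p ≤ q → 0 ≤ c → c ≤ 2 →
      c * (K * σ ^ p * I k) ≤ M * K * σ ^ q := fun {k p q c} hk hpq hc0 hc2 => by
    have h1 : σ ^ p ≤ σ ^ q := Real.rpow_le_rpow_of_exponent_le hσ hpq
    have h2 : c * I k ≤ M := (mul_le_mul_of_nonneg_right hc2 (hI0 k)).trans (hIM k hk)
    calc c * (K * σ ^ p * I k) = c * I k * K * σ ^ p := by ring
      _ ≤ _ := by gcongr
  refine ⟨((bumpConv_smooth hFi σ m).1).contDiffOn, fun k hk x hx => ?_, fun x hx y hy => ?_⟩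
  · rcases eq_or_ne k 0 with rfl | hk0
    · refine (hf.abs_bumpConv_le hα0 hσ x).trans ?_
      have h := bound (k := 0) (p := 0) (q := θ) (c := 1) (Nat.zero_le _) hθ0.le zero_le_one
        one_le_two
      rwa [one_mul, Real.rpow_zero, mul_one] at h
    · refine (hf.norm_iteratedFDeriv_bumpConv_le hα0 hσ hk0 hx).trans ?_
      have hk1 : (k : ℝ) ≤ m := by exact_mod_cast hk
      simpa using bound (k := k) (p := k - α) (q := θ) (c := 1) (by omega) (by linarith)
        zero_le_one one_le_two
  · have hd0 : 0 ≤ dist x y := dist_nonneg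
    rcases hd0.eq_or_lt with hd | hd
    · have hxy : x = y := dist_eq_zero.1 hd.symm
      rw [hxy, sub_self, norm_zero]
      positivity
    rcases le_total (σ * dist x y) 1 with h1 | h1
    · refine (norm_iteratedFDeriv_sub_le ((bumpConv_smooth hFi σ (m + 1)).1)
        (convex_ball (0 : Euc n) (1 / 2))
        (fun z hz => hf.norm_iteratedFDeriv_bumpConv_le hα0 hσ m.succ_ne_zero hz) hx hy).trans ?_
      have h2 : dist x y ≤ σ ^ (β - 1) * dist x y ^ β := by
        have h3 := Real.rpow_le_one (by positivity) h1 (sub_nonneg.2 hβ1)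
        rw [Real.mul_rpow hσ0.le hd0] at h3
        have h4 : σ ^ (1 - β) * σ ^ (β - 1) = 1 := by
          rw [← Real.rpow_add hσ0]
          simp
        have h5 : dist x y ^ (1 - β) * dist x y ^ β = dist x y := by
          rw [← Real.rpow_add hd]
          simp
        calc dist x y = (σ ^ (1 - β) * dist x y ^ (1 - β)) * (σ ^ (β - 1) * dist x y ^ β) := by
              rw [mul_mul_mul_comm, h4, h5, one_mul]
          _ ≤ 1 * (σ ^ (β - 1) * dist x y ^ β) := by gcongr
          _ = _ := one_mul _
      have hc : 0 ≤ K * σ ^ (((m + 1 : ℕ) : ℝ) - α) * I (m + 1) := by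
        have := hI0 (m + 1)
        positivity
      refine (mul_le_mul_of_nonneg_left h2 hc).trans ?_
      rw [← mul_assoc]
      refine mul_le_mul_of_nonneg_right ?_ (by positivity)
      have h6 := bound (k := m + 1) (p := ((m + 1 : ℕ) : ℝ) - α + (β - 1)) (q := θ) (c := 1) le_rfl
        (by push_cast; linarith) zero_le_one one_le_two
      rw [Real.rpow_add hσ0] at h6
      refine le_trans (le_of_eq ?_) h6
      ring
    · have h2 : ∀ p : ℝ, 0 ≤ p → 1 ≤ σ ^ p * dist x y ^ p := fun p hp => by
        rw [← Real.mul_rpow hσ0.le hd0]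
        exact Real.one_le_rpow h1 hp
      rcases eq_or_ne m 0 with rfl | hm
      · refine (hf.abs_bumpConv_sub_le hα0 hσ hx hy).trans ?_
        have hβα : 0 ≤ β - α := by
          push_cast at hθ
          linarith
        have h3 : dist x y ^ α ≤ σ ^ θ * dist x y ^ β := by
          have h4 := h2 (β - α) hβα
          have h5 : dist x y ^ (β - α) * dist x y ^ α = dist x y ^ β := by
            rw [← Real.rpow_add hd]
            simp
          have h6 : θ = β - α := by
            push_cast at hθ
            linarith
          calc dist x y ^ α = 1 * dist x y ^ α := (one_mul _).symm
            _ ≤ (σ ^ (β - α) * dist x y ^ (β - α)) * dist x y ^ α := by gcongr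
            _ = _ := by rw [mul_assoc, h5, h6]
        have h7 : I 0 ≤ M := by linarith [hI0 0, hIM 0 (Nat.zero_le _)]
        calc K * dist x y ^ α * I 0 ≤ K * (σ ^ θ * dist x y ^ β) * M := by
              have := hI0 0
              gcongr
          _ = _ := by ring
      · have hD := fun z hz => hf.norm_iteratedFDeriv_bumpConv_le hα0 hσ hm (x := z) hz
        refine (norm_sub_le_of_le (hD x hx) (hD y hy)).trans ?_
        have h6 := bound (k := m) (p := m - α) (q := m - α) (c := 2) (Nat.le_succ m) le_rfl
          zero_le_two le_rfl
        rw [← two_mul]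
        refine h6.trans ?_
        rw [hθ, Real.rpow_add hσ0]
        have h8 : 0 ≤ M * K * σ ^ (m - α) := by positivity
        calc _ = M * K * σ ^ (m - α) * 1 := (mul_one _).symm
          _ ≤ M * K * σ ^ (m - α) * (σ ^ β * dist x y ^ β) :=
            mul_le_mul_of_nonneg_left (h2 β hβ0) h8
          _ = _ := by ring

theorem exists_higherHolderBoundOn_integral_bumpConv (n : ℕ) (hα0 : 0 < α) (hβ0 : 0 ≤ β)
    (hβ1 : β ≤ 1) (hε0 : 0 < ε) (hε : ε < 2 * s) (hm : 2 * s - ε = m - α + β) :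
    ∃ M, 0 ≤ M ∧ ∀ (f : Euc n → ℝ) (K : ℝ), HolderBoundOn n α f (ball (0 : Euc n) 1) K →
      HigherHolderBoundOn n m β (fun x => ∫ σ in Ioi 1, σ ^ (-1 - 2 * s) *
        bumpConv n ((ball 0 1).indicator f) σ x) (ball (0 : Euc n) (1 / 2)) (M * K) := by
  obtain ⟨M, hM0, hM⟩ := exists_higherHolderBoundOn_bumpConv n hα0 hβ0 hβ1 (sub_pos.2 hε) hm
  refine ⟨M * ε⁻¹, by positivity, fun f K hf => ?_⟩
  have hFi := integrable_indicator_ball (hf.continuousOn hα0) hf.1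
  have hFm := measurable_indicator_ball (hf.continuousOn hα0)
  have h := higherHolderBoundOn_integral (n := n) (m := m) (β := β)
    (μ := volume.restrict (Ioi (1 : ℝ)))
    (F := fun σ x => σ ^ (-1 - 2 * s) * bumpConv n ((ball 0 1).indicator f) σ x)
    (b := fun σ => M * K * σ ^ (-1 - ε)) (U := ball (0 : Euc n) (1 / 2)) isOpen_ball
    (fun σ => contDiff_const.mul (bumpConv_smooth hFi σ m).1) ?_
    ((integrableOn_rpow_Ioi_one hε0).const_mul _) ?_
  · rw [integral_const_mul, integral_rpow_Ioi_one hε0] at h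
    rwa [mul_right_comm]
  · intro k _ x _
    have e : (fun σ : ℝ => iteratedFDeriv ℝ k (fun x => σ ^ (-1 - 2 * s) *
        bumpConv n ((ball 0 1).indicator f) σ x) x) = fun σ => σ ^ (-1 - 2 * s) •
          iteratedFDeriv ℝ k (bumpConv n ((ball 0 1).indicator f) σ) x := by
      ext1 σ
      exact iteratedFDeriv_const_smul_apply' (𝕜 := ℝ) (R := ℝ) (a := σ ^ (-1 - 2 * s))
        (bumpConv_smooth hFi σ k).1.contDiffAt
    rw [e]
    exact (by fun_prop : Measurable fun σ : ℝ => σ ^ (-1 - 2 * s)).aestronglyMeasurable.smul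
      (stronglyMeasurable_iteratedFDeriv_bumpConv hFm hFi k x).aestronglyMeasurable
  · filter_upwards [ae_restrict_mem measurableSet_Ioi] with σ hσ
    have hσ0 : (0 : ℝ) < σ := zero_lt_one.trans hσ
    refine ((hM f K hf σ (le_of_lt hσ)).const_mul isOpen_ball
      (Real.rpow_nonneg hσ0.le (-1 - 2 * s))).mono (le_of_eq ?_)
    rw [mul_left_comm, ← Real.rpow_add hσ0]
    congr 2
    ring

end LocalPart

section Assembly

variable {n m : ℕ} {s α β ε Kf Ku : ℝ} {u f : Euc n → ℝ}

theorem integrableOn_bumpConv (hs0 : 0 < s) (hα0 : 0 < α)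
    (hf : HolderBoundOn n α f (ball (0 : Euc n) 1) Kf) (x : Euc n) :
    IntegrableOn (fun σ : ℝ => σ ^ (-1 - 2 * s) * bumpConv n ((ball 0 1).indicator f) σ x)
      (Ioi 1) := by
  have hFi := integrable_indicator_ball (hf.continuousOn hα0) hf.1
  have hFm := measurable_indicator_ball (hf.continuousOn hα0)
  have hmeas : StronglyMeasurable (fun σ => bumpConv n ((ball 0 1).indicator f) σ x) := by
    have h := (continuousMultilinearCurryFin0 ℝ (Euc n) ℝ).continuous.comp_stronglyMeasurable
      (stronglyMeasurable_iteratedFDeriv_bumpConv hFm hFi 0 x)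
    simpa [Function.comp_def] using h
  refine (integrableOn_rpow_Ioi_one (a := 2 * s) (by positivity)).mul_bdd
    (c := Kf * ∫ z, ‖iteratedFDeriv ℝ 0 (radBump n) z‖) hmeas.aestronglyMeasurable ?_
  filter_upwards [ae_restrict_mem measurableSet_Ioi] with σ hσ
  have h := hf.abs_bumpConv_le hα0 (le_of_lt hσ) x
  rwa [norm_iteratedFDeriv_zero] at h

theorem mul_integral_rho_eq (hn : 1 ≤ n) (hs0 : 0 < s) (hs1 : s < 1) (hα0 : 0 < α)
    (hu : C11LocOn n u univ) (hu2 : MemL2s n s u)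
    (hlap : ∀ x ∈ ball (0 : Euc n) 1, HasFracLapAt n s u x (f x))
    (hf : HolderBoundOn n α f (ball (0 : Euc n) 1) Kf) {x : Euc n}
    (hx : x ∈ ball (0 : Euc n) (1 / 2)) :
    u x * ∫ z, rho n s z = (∫ y, u y * rho n s (x - y)) +
      2 / fracC n s * ∫ σ in Ioi 1, σ ^ (-1 - 2 * s) *
        bumpConv n ((ball 0 1).indicator f) σ x := by
  have hx1 : ‖x‖ ≤ 1 := by
    rw [mem_ball_zero_iff] at hx
    linarith
  have h1 := tendsto_integral_mul_rho hn hs0 hs1 hu.continuous (hu2.integrable_mul_wt hn hs0) hx1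
  have h2 := ((intervalIntegral_tendsto_integral_Ioi 1 (integrableOn_bumpConv hs0 hα0 hf x)
    tendsto_id).const_mul (2 / fracC n s)).const_add (∫ y, u y * rho n s (x - y))
  refine tendsto_nhds_unique h1 (h2.congr' ?_)
  filter_upwards [eventually_ge_atTop 1] with b hb
  rw [id, ← integral_mul_rho_sub hn hs0 hs1 hu hu2 hlap hx hb, add_sub_cancel]

theorem exists_integral_mul_wt_le (hn : 1 ≤ n) (hs0 : 0 < s) (hs1 : s < 1) (hα0 : 0 < α)
    {M : ℝ} (hM : ∀ (f : Euc n → ℝ) (K : ℝ), HolderBoundOn n α f (ball (0 : Euc n) 1) K →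
      HigherHolderBoundOn n m β (fun x => ∫ σ in Ioi 1, σ ^ (-1 - 2 * s) *
        bumpConv n ((ball 0 1).indicator f) σ x) (ball (0 : Euc n) (1 / 2)) (M * K))
    (hM0 : 0 ≤ M) :
    ∃ C, 0 ≤ C ∧ ∀ (u f : Euc n → ℝ) (Kf Ku : ℝ), (∀ x, 0 ≤ u x) → C11LocOn n u univ →
      MemL2s n s u → (∀ x ∈ ball (0 : Euc n) 1, HasFracLapAt n s u x (f x)) →
      HolderBoundOn n α f (ball (0 : Euc n) 1) Kf → (∀ x ∈ ball (0 : Euc n) 1, u x ≤ Ku) →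
      ∫ y, u y * wt n s y ≤ C * (Kf + Ku) := by
  obtain ⟨c, hc0, hc⟩ := exists_le_rho (n := n) hn hs0 hs1
  have hfc := fracC_pos (n := n) hs0 hs1
  have hρ := integral_rho_pos (n := n) hn hs0 hs1
  have hW : 0 ≤ ∫ y, wt n s y := integral_nonneg fun y => (wt_pos y).le
  set R := ∫ z, rho n s z
  set W := ∫ y, wt n s y
  refine ⟨W + c⁻¹ * (R + 2 / fracC n s * M), by positivity,
    fun u f Kf Ku hu0 hu hu2 hlap hf hKu => ?_⟩
  have hKu0 : 0 ≤ Ku := (hu0 0).trans (hKu 0 (by simp))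
  have hKf0 := hf.nonneg ⟨0, by simp⟩
  have hw := hu2.integrable_mul_wt hn hs0
  have h0 : (0 : Euc n) ∈ ball (0 : Euc n) (1 / 2) := by simp
  have e := mul_integral_rho_eq hn hs0 hs1 hα0 hu hu2 hlap hf h0
  have hi : Integrable (fun y => u y * rho n s (0 - y)) := by
    simpa using integrable_mul_rho (x := 0) hn hs0 hs1 hu.continuous hw (by simp) le_rfl
  have hV := (hM f Kf hf).2.1 0 (Nat.zero_le _) 0 h0
  rw [norm_iteratedFDeriv_zero, Real.norm_eq_abs] at hV
  have hV1 := (abs_le.1 hV).1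
  have h1 : ∫ y, u y * rho n s (0 - y) ≤ Ku * R + 2 / fracC n s * (M * Kf) := by
    have h2 : u 0 * R ≤ Ku * R := mul_le_mul_of_nonneg_right (hKu 0 (by simp)) hρ.le
    have h3 := mul_le_mul_of_nonneg_left hV1 (by positivity : 0 ≤ 2 / fracC n s)
    linarith
  have h2 : ∫ y, u y * wt n s y ≤ ∫ y, (Ku * wt n s y + c⁻¹ * (u y * rho n s (0 - y))) := by
    refine integral_mono hw (((integrable_wt hs0).const_mul _).add (hi.const_mul _)) fun y => ?_
    have h3 := (wt_pos (n := n) (s := s) y).le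
    have h4 := mul_nonneg (hu0 y) (rho_nonneg (n := n) hn hs0 hs1 (0 - y))
    by_cases hy : y ∈ ball (0 : Euc n) 1
    · have h5 := mul_le_mul_of_nonneg_right (hKu y hy) h3
      have h6 := mul_nonneg (inv_nonneg.2 hc0.le) h4
      linarith
    · rw [mem_ball_zero_iff, not_lt] at hy
      have h5 := hc (0 - y) (by simpa using hy)
      rw [zero_sub, wt_neg] at h5
      have h6 : wt n s y ≤ c⁻¹ * rho n s (0 - y) := by
        rwa [zero_sub, inv_mul_eq_div, le_div_iff₀' hc0]
      have h7 := mul_le_mul_of_nonneg_left h6 (hu0 y)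
      have h8 := mul_nonneg hKu0 h3
      rw [mul_left_comm] at h7
      linarith
  rw [integral_add ((integrable_wt hs0).const_mul _) (hi.const_mul _), integral_const_mul,
    integral_const_mul] at h2
  have h3 := mul_le_mul_of_nonneg_left h1 (inv_nonneg.2 hc0.le)
  have h4 : 0 ≤ W * Kf := mul_nonneg hW hKf0
  have h5 : 0 ≤ c⁻¹ * (R * Kf) := by positivity
  have h6 : 0 ≤ c⁻¹ * (2 / fracC n s * M * Ku) := by positivity
  calc _ ≤ _ := h2
    _ ≤ Ku * W + c⁻¹ * (Ku * R + 2 / fracC n s * (M * Kf)) := by gcongr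
    _ ≤ _ := by linarith

theorem iteratedFDeriv_mul_rho_sub (hn : 1 ≤ n) (hs0 : 0 < s) (hs1 : s < 1) (k : ℕ) (c : ℝ)
    (x y : Euc n) : iteratedFDeriv ℝ k (fun x => c * rho n s (x - y)) x =
      c • iteratedFDeriv ℝ k (rho n s) (x - y) := by
  have h := (rho_smooth (n := n) hn hs0 hs1 k).1
  have h1 : ContDiff ℝ k (fun x : Euc n => rho n s (x - y)) := h.comp (by fun_prop)
  rw [← iteratedFDeriv_comp_sub]
  exact iteratedFDeriv_const_smul_apply' (𝕜 := ℝ) (R := ℝ) (a := c) h1.contDiffAt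

theorem exists_higherHolderBoundOn_integral_mul_rho (hn : 1 ≤ n) (hs0 : 0 < s) (hs1 : s < 1)
    (m : ℕ) (hβ1 : β ≤ 1) :
    ∃ C, 0 ≤ C ∧ ∀ u : Euc n → ℝ, (∀ x, 0 ≤ u x) → Continuous u →
      Integrable (fun y => u y * wt n s y) →
      HigherHolderBoundOn n m β (fun x => ∫ y, u y * rho n s (x - y)) (ball (0 : Euc n) (1 / 2))
        (C * ∫ y, u y * wt n s y) := by
  choose D hD0 hD using exists_norm_iteratedFDeriv_rho_le (n := n) hn hs0 hs1
  obtain ⟨c, hc0, hc⟩ := exists_wt_sub_le n hs0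
  set S := ∑ k ∈ Finset.range (m + 2), D k with hS
  have hS0 : 0 ≤ S := Finset.sum_nonneg fun k _ => hD0 k
  have hDS : ∀ k ≤ m + 1, D k ≤ S := fun k hk => Finset.single_le_sum (fun k _ => hD0 k)
    (Finset.mem_range.2 (Nat.lt_succ_of_le hk))
  refine ⟨S * c, by positivity, fun u hu0 huc hw => ?_⟩
  have key : ∀ k ≤ m + 1, ∀ y, ∀ x ∈ ball (0 : Euc n) (1 / 2),
      ‖iteratedFDeriv ℝ k (fun x => u y * rho n s (x - y)) x‖ ≤ S * c * (u y * wt n s y) := by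
    intro k hk y x hx
    rw [mem_ball_zero_iff] at hx
    rw [iteratedFDeriv_mul_rho_sub hn hs0 hs1, norm_smul, Real.norm_of_nonneg (hu0 y)]
    have h1 := hc x y (by linarith)
    calc _ ≤ u y * (D k * wt n s (x - y)) := mul_le_mul_of_nonneg_left (hD k _) (hu0 y)
      _ ≤ u y * (S * (c * wt n s y)) := mul_le_mul_of_nonneg_left
          (mul_le_mul (hDS k hk) h1 (wt_pos _).le hS0) (hu0 y)
      _ = _ := by ring
  have hsm : ∀ (k : ℕ) y, ContDiff ℝ k (fun x => u y * rho n s (x - y)) := fun k y =>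
    contDiff_const.mul ((rho_smooth (n := n) hn hs0 hs1 k).1.comp (by fun_prop))
  rw [← integral_const_mul]
  refine higherHolderBoundOn_integral (F := fun y x => u y * rho n s (x - y)) isOpen_ball (hsm m)
    (fun k _ x _ => ?_) (hw.const_mul _) (Eventually.of_forall fun y =>
      ⟨(hsm m y).contDiffOn, fun k hk x hx => key k (by omega) y x hx, fun x hx x' hx' => ?_⟩)
  · simp only [iteratedFDeriv_mul_rho_sub hn hs0 hs1]
    have h1 : Continuous (iteratedFDeriv ℝ k (rho n s)) :=
      (rho_smooth (n := n) hn hs0 hs1 k).1.continuous_iteratedFDeriv le_rfl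
    exact (huc.smul (h1.comp (by fun_prop : Continuous fun y : Euc n => x - y))).aestronglyMeasurable
  · refine (norm_iteratedFDeriv_sub_le (hsm (m + 1) y) (convex_ball (0 : Euc n) (1 / 2))
      (key (m + 1) le_rfl y) hx hx').trans ?_
    have h1 : dist x x' ≤ 1 := by
      rw [mem_ball] at hx hx'
      linarith [dist_triangle_right x x' 0]
    have h2 : dist x x' ≤ dist x x' ^ β := by
      rcases (dist_nonneg (x := x) (y := x')).eq_or_lt with h | h
      · rw [← h]
        positivity
      · simpa using Real.rpow_le_rpow_of_exponent_ge h h1 hβ1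
    exact mul_le_mul_of_nonneg_left h2
      (mul_nonneg (mul_nonneg hS0 hc0) (mul_nonneg (hu0 y) (wt_pos y).le))

end Assembly

/-- interior Schauder regularity: if `u ∈ C^{1,1}_{loc}(ℝⁿ) ∩ L_{2s}` is
a nonnegative classical solution of `(-Δ)^s u = f` in `B₁(0)` with `f ∈ C^α(B₁(0))`,
`0 < α < 1`, then for every `0 < ε < 2s`,
`‖u‖_{C^{[2s+α-ε],{2s+α-ε}}(B_{1/2})} ≤ C (‖f‖_{C^α(B₁)} + ‖u‖_{L^∞(B₁)})`,
with `C = C(n,s,α,ε)`. -/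
theorem interior_schauder_regularity
    (n : ℕ) (hn : 1 ≤ n) (s : ℝ) (hs0 : 0 < s) (hs1 : s < 1)
    (α : ℝ) (hα0 : 0 < α) (hα1 : α < 1)
    (ε : ℝ) (hε0 : 0 < ε) (hε1 : ε < 2 * s) :
    ∃ C : ℝ, 0 < C ∧
      ∀ (u f : Euc n → ℝ) (Kf Ku : ℝ),
        (∀ x, 0 ≤ u x) → C11LocOn n u univ → MemL2s n s u →
        (∀ x ∈ ball (0 : Euc n) 1, HasFracLapAt n s u x (f x)) →
        HolderBoundOn n α f (ball (0 : Euc n) 1) Kf →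
        (∀ x ∈ ball (0 : Euc n) 1, u x ≤ Ku) →
        HigherHolderBoundOn n ⌊2 * s + α - ε⌋₊ (2 * s + α - ε - (⌊2 * s + α - ε⌋₊ : ℝ)) u
          (ball (0 : Euc n) (1/2)) (C * (Kf + Ku)) := by
  set m := ⌊2 * s + α - ε⌋₊ with hm
  set β := 2 * s + α - ε - (m : ℝ) with hβ
  have hβ0 : 0 ≤ β := sub_nonneg.2 (Nat.floor_le (by linarith))
  have hβ1 : β ≤ 1 := by
    have := Nat.lt_floor_add_one (2 * s + α - ε)
    linarith
  obtain ⟨M, hM0, hM⟩ := exists_higherHolderBoundOn_integral_bumpConv (m := m) (s := s) n hα0 hβ0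
    hβ1 hε0 hε1 (by rw [hβ]; ring)
  obtain ⟨T, hT0, hT⟩ := exists_integral_mul_wt_le hn hs0 hs1 hα0 hM hM0
  obtain ⟨D, hD0, hD⟩ := exists_higherHolderBoundOn_integral_mul_rho hn hs0 hs1 m hβ1
  have hfc := fracC_pos (n := n) hs0 hs1
  have hρ := integral_rho_pos (n := n) hn hs0 hs1
  refine ⟨(∫ z, rho n s z)⁻¹ * (D * T + 2 / fracC n s * M) + 1, by positivity,
    fun u f Kf Ku hu0 hu hu2 hlap hf hKu => ?_⟩
  have hKu0 : 0 ≤ Ku := (hu0 0).trans (hKu 0 (by simp))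
  have hKf0 := hf.nonneg ⟨0, by simp⟩
  have h1 := ((hD u hu0 hu.continuous (hu2.integrable_mul_wt hn hs0)).add isOpen_ball
    ((hM f Kf hf).const_mul isOpen_ball (by positivity : 0 ≤ 2 / fracC n s))).const_mul
      isOpen_ball (inv_nonneg.2 hρ.le)
  refine (h1.congr isOpen_ball fun x hx => ?_).mono ?_
  · rw [eq_inv_mul_iff_mul_eq₀ hρ.ne', mul_comm]
    exact mul_integral_rho_eq hn hs0 hs1 hα0 hu hu2 hlap hf hx
  · have h2 := mul_le_mul_of_nonneg_left (hT u f Kf Ku hu0 hu hu2 hlap hf hKu) hD0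
    have h3 : 2 / fracC n s * (M * Kf) ≤ 2 / fracC n s * (M * (Kf + Ku)) := by
      gcongr
      linarith
    calc _ ≤ (∫ z, rho n s z)⁻¹ * (D * (T * (Kf + Ku)) + 2 / fracC n s * (M * (Kf + Ku))) :=
          mul_le_mul_of_nonneg_left (add_le_add h2 h3) (inv_nonneg.2 hρ.le)
      _ ≤ _ := by linarith
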